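/- arXiv:2402.13237 — 13 statements merged into one kernel-verified Lean document; each statement's English description precedes it below -/
import Mathlib

section
/- For every 0-C1PVASS and every real number k > 0: there exists a k-covering run if and only if there exists a k-reaching run. -/
/-- A stack operation: push a symbol or pop a symbol. -/
inductive StackOp (Γ : Type) where
  | push : Γ → StackOp Γ
  | pop  : Γ → StackOp Γ

/-- A continuous one-dimensional pushdown VASS `(S,Γ,δ,⊥,s₀,f,ℓ)`. -/
structure C1PVASS (S Γ : Type) where
  /-- partial transition function: counter update and optional stack operation -/
  δ : S → S → Option (ℤ × Option (StackOp Γ))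
  /-- initial stack symbol -/
  bot : Γ
  /-- initial state -/
  s0 : S
  /-- final state -/
  f : S
  /-- lower-bound guards on the states -/
  lb : S → ℕ

/-- A configuration: state, stack content (head = top of stack), counter value. -/
structure Config (S Γ : Type) where
  state : S
  stack : List Γ
  counter : ℝ

namespace C1PVASS

variable {S Γ : Type}

/-- The initial configuration `(s₀, ⊥, 0)`. -/
def init (A : C1PVASS S Γ) : Config S Γ := ⟨A.s0, [A.bot], 0⟩

/-- How an optional stack operation relates the stack contents before and after a
transition; pushed/popped symbols must differ from `⊥`. -/
def StackOk (A : C1PVASS S Γ) : Option (StackOp Γ) → List Γ → List Γ → Prop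
  | none, α, β => β = α
  | some (.push a), α, β => a ≠ A.bot ∧ β = a :: α
  | some (.pop a), α, β => a ≠ A.bot ∧ α = a :: β

/-- One step of the continuous semantics with scaling factor `γ ∈ (0,1]`:
the counter changes by `γ * u` and the resulting counter value must satisfy the
lower-bound guard of the target state. -/
def Step (A : C1PVASS S Γ) (q q' : Config S Γ) (γ : ℝ) : Prop :=
  ∃ u op, A.δ q.state q'.state = some (u, op) ∧
    0 < γ ∧ γ ≤ 1 ∧
    q'.counter = q.counter + γ * (u : ℝ) ∧
    (A.lb q'.state : ℝ) ≤ q'.counter ∧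
    A.StackOk op q.stack q'.stack

/-- `π 0, π 1, …, π n` is a run of `A` with scaling factors `γ 0, …, γ (n-1)`. -/
def IsRunWith (A : C1PVASS S Γ) (n : ℕ) (π : ℕ → Config S Γ) (γ : ℕ → ℝ) : Prop :=
  π 0 = A.init ∧ ∀ i < n, A.Step (π i) (π (i+1)) (γ i)

/-- `π 0, π 1, …, π n` is a run of `A` (for some choice of scaling factors). -/
def IsRun (A : C1PVASS S Γ) (n : ℕ) (π : ℕ → Config S Γ) : Prop :=
  ∃ γ, A.IsRunWith n π γ

/-- The set of final counter values of accepting runs of `A`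
(a run is accepting if it ends in the final state `f`). -/
def AccValues (A : C1PVASS S Γ) : Set ℝ :=
  {c | ∃ n π, A.IsRun n π ∧ (π n).state = A.f ∧ (π n).counter = c}

/-- `A` is a 0-C1PVASS: all lower-bound guards are `0`. -/
def ZeroLB (A : C1PVASS S Γ) : Prop := ∀ s, A.lb s = 0

/-- All counter updates of `A` lie in `{-1, 0, +1}`. -/
def UpdatesIn (A : C1PVASS S Γ) : Prop :=
  ∀ s s' u op, A.δ s s' = some (u, op) → u = -1 ∨ u = 0 ∨ u = 1

/-- The counter update labelling the transition from `s` to `s'` (if any). -/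
def upd (A : C1PVASS S Γ) (s s' : S) : Option ℤ := (A.δ s s').map Prod.fst

/-- One step of the underlying PDA (counter updates and lower bounds erased). -/
def PDAStep (A : C1PVASS S Γ) (p p' : S × List Γ) : Prop :=
  ∃ u op, A.δ p.1 p'.1 = some (u, op) ∧ A.StackOk op p.2 p'.2

/-- `ρ 0, …, ρ n` is a run of the underlying PDA of `A`,
starting at `(s₀, ⊥)`. -/
def IsPDARun (A : C1PVASS S Γ) (n : ℕ) (ρ : ℕ → S × List Γ) : Prop :=
  ρ 0 = (A.s0, [A.bot]) ∧ ∀ i < n, A.PDAStep (ρ i) (ρ (i+1))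

end C1PVASS

/-- For every 0-C1PVASS and every real `k > 0`,
there is a `k`-covering run iff there is a `k`-reaching run. -/
theorem stmt1 {S Γ : Type} (A : C1PVASS S Γ) (h0 : A.ZeroLB) (k : ℝ) (hk : 0 < k) :
    (∃ c ∈ A.AccValues, k ≤ c) ↔ k ∈ A.AccValues := by
  constructor
  · rintro ⟨c, ⟨n, π, ⟨γ, hinit, hstep⟩, hf, hc⟩, hkc⟩
    have hcpos : 0 < c := lt_of_lt_of_le hk hkc
    have ht0 : 0 < k / c := div_pos hk hcpos
    have ht1 : k / c ≤ 1 := (div_le_one hcpos).mpr hkc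
    refine ⟨n, fun i => ⟨(π i).state, (π i).stack, k / c * (π i).counter⟩,
      ⟨fun i => k / c * γ i, ?_, ?_⟩, hf, ?_⟩
    · simp [hinit, C1PVASS.init]
    · intro i hi
      obtain ⟨u, op, hδ, hγ0, hγ1, hcnt, hlb, hst⟩ := hstep i hi
      refine ⟨u, op, hδ, mul_pos ht0 hγ0, mul_le_one₀ ht1 hγ0.le hγ1, ?_, ?_, hst⟩
      · simp only [hcnt]
        ring
      · rw [h0, Nat.cast_zero] at hlb
        rw [h0, Nat.cast_zero]
        exact mul_nonneg ht0.le hlb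
    · simp only [hc]
      exact div_mul_cancel₀ k hcpos.ne'
  · intro h
    exact ⟨k, h, le_rfl⟩
end

section
/- For every 0-C1PVASS, if there is a k-reaching run for some real k > 0, then for every real k' with 0 < k' ≤ k there is a k'-reaching run. -/
/-- For every 0-C1PVASS, if there is a `k`-reaching run for some real
`k > 0`, then for every real `k'` with `0 < k' ≤ k` there is a `k'`-reaching run. -/
theorem stmt3 {S Γ : Type} (A : C1PVASS S Γ) (h0 : A.ZeroLB) (k k' : ℝ)
    (hk0 : 0 < k) (hk : k ∈ A.AccValues) (hk'0 : 0 < k') (hk'k : k' ≤ k) :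
    k' ∈ A.AccValues := by
  obtain ⟨n, π, ⟨γ, hinit, hstep⟩, hf, hc⟩ := hk
  have hr : 0 < k' / k := div_pos hk'0 hk0
  have hr1 : k' / k ≤ 1 := (div_le_one hk0).2 hk'k
  refine ⟨n, fun i => ⟨(π i).state, (π i).stack, (k' / k) * (π i).counter⟩,
    ⟨fun i => (k' / k) * γ i, ?_, ?_⟩, hf, ?_⟩
  · simp [hinit, C1PVASS.init]
  · intro i hi
    obtain ⟨u, op, hδ, hγ0, hγ1, hcnt, hlb, hst⟩ := hstep i hi
    refine ⟨u, op, hδ, mul_pos hr hγ0, mul_le_one₀ hr1 hγ0.le hγ1, ?_, ?_, hst⟩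
    · simp only [hcnt]
      ring
    · simp only [h0 (π (i+1)).state, Nat.cast_zero] at hlb ⊢
      exact mul_nonneg hr.le hlb
  · simp only [hc]
    field_simp
end

section
/- For every 0-C1PVASS, the set of nonzero final counter values of accepting runs is order-convex: if k is the final counter value of some accepting run and 0 < k' ≤ k, then k' is also the final counter value of some accepting run. Hence this set is an interval with left endpoint 0. -/
/-- For every 0-C1PVASS, the set of nonzero final counter values of
accepting runs is order-convex: if `k` is the final counter value of some accepting
run and `0 < k' ≤ k`, then so is `k'`.  Hence this set is an interval with left
endpoint `0`. -/
theorem stmt4 {S Γ : Type} (A : C1PVASS S Γ) (h0 : A.ZeroLB) :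
    (∀ k ∈ A.AccValues, ∀ k' : ℝ, 0 < k' → k' ≤ k → k' ∈ A.AccValues) ∧
    (A.AccValues \ {0}).OrdConnected ∧
    ((A.AccValues \ {0}).Nonempty → IsGLB (A.AccValues \ {0}) 0) := by
  have hnn : ∀ k ∈ A.AccValues, 0 ≤ k := by
    rintro k ⟨n, π, ⟨γ, hi, hs⟩, -, rfl⟩
    cases n with
    | zero => rw [hi]; exact le_rfl
    | succ m =>
      obtain ⟨u, op, -, -, -, -, hl, -⟩ := hs m (Nat.lt_succ_self m)
      exact le_trans (Nat.cast_nonneg _) hl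
  have key : ∀ k ∈ A.AccValues, ∀ k' : ℝ, 0 < k' → k' ≤ k → k' ∈ A.AccValues := by
    rintro k ⟨n, π, ⟨γ, hi, hs⟩, hf, hk⟩ k' hk' hle
    have hkpos : 0 < k := lt_of_lt_of_le hk' hle
    have hr : 0 < k' / k := div_pos hk' hkpos
    have hr1 : k' / k ≤ 1 := (div_le_one hkpos).2 hle
    refine ⟨n, fun i => ⟨(π i).state, (π i).stack, k' / k * (π i).counter⟩,
      ⟨fun i => k' / k * γ i, ?_, ?_⟩, hf, ?_⟩
    · simp [hi, C1PVASS.init]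
    · intro i hin
      obtain ⟨u, op, hd, hg, hg1, hc, hl, hst⟩ := hs i hin
      refine ⟨u, op, hd, mul_pos hr hg, mul_le_one₀ hr1 hg.le hg1, ?_, ?_, hst⟩
      · simp only [hc]; ring
      · simp only [h0 _, Nat.cast_zero] at hl ⊢
        exact mul_nonneg hr.le hl
    · simp only [hk]
      exact div_mul_cancel₀ k' hkpos.ne'
  refine ⟨key, ⟨?_⟩, ?_⟩
  · rintro x ⟨hx, hx0⟩ y ⟨hy, -⟩ z ⟨hxz, hzy⟩
    have hxp : 0 < x := lt_of_le_of_ne (hnn x hx) (fun h => hx0 h.symm)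
    have hz : 0 < z := lt_of_lt_of_le hxp hxz
    exact ⟨key y hy z hz hzy, hz.ne'⟩
  · rintro ⟨x, hx, hx0⟩
    have hxp : 0 < x := lt_of_le_of_ne (hnn x hx) (fun h => hx0 h.symm)
    refine ⟨fun y hy => hnn y hy.1, fun b hb => ?_⟩
    by_contra! hb0
    have hm : 0 < min x (b / 2) := lt_min hxp (half_pos hb0)
    have h1 := hb ⟨key x hx _ hm (min_le_left _ _), hm.ne'⟩
    have h2 := min_le_right x (b / 2)
    linarith
end

section
/- If the set of final counter values of accepting runs of a 0-C1PVASS (with counter updates in {−1,0,+1}) is nonempty and bounded above, then its supremum is a natural number. -/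
open Classical in
/-- Number of `+1` transitions among the first `k` steps of `π`. -/
noncomputable def posCount {S Γ : Type} (A : C1PVASS S Γ) (π : ℕ → Config S Γ) (k : ℕ) : ℕ :=
  ∑ i ∈ Finset.range k, if A.upd (π i).state (π (i+1)).state = some 1 then 1 else 0

theorem run_bounds {S Γ : Type} (A : C1PVASS S Γ) (h0 : A.ZeroLB) (hupd : A.UpdatesIn)
    (n : ℕ) (π : ℕ → Config S Γ) (hr : A.IsRun n π) :
    ∀ k ≤ n, 0 ≤ (π k).counter ∧ (π k).counter ≤ posCount A π k := by
  obtain ⟨γ, hi, hs⟩ := hr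
  intro k
  induction k with
  | zero => intro _; simp [hi, C1PVASS.init, posCount]
  | succ k ih =>
    intro hk
    obtain ⟨_, h2⟩ := ih (by omega)
    obtain ⟨u, op, hd, hg, hg1, hc, hl, _⟩ := hs k (by omega)
    have hl' : (0:ℝ) ≤ (π (k+1)).counter := by simpa [h0 _] using hl
    refine ⟨hl', ?_⟩
    have hP : posCount A π (k+1) = posCount A π k + if u = 1 then 1 else 0 := by
      simp [posCount, Finset.sum_range_succ, C1PVASS.upd, hd]
    rw [hP, hc]
    rcases hupd _ _ _ _ hd with rfl | rfl | rfl <;> norm_num <;> linarith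

theorem run_mix {S Γ : Type} (A : C1PVASS S Γ) (h0 : A.ZeroLB) (hupd : A.UpdatesIn)
    (n : ℕ) (π : ℕ → Config S Γ) (hr : A.IsRun n π) (hf : (π n).state = A.f)
    (ε : ℝ) (he : 0 < ε) (he1 : ε ≤ 1) :
    (1 - ε) * posCount A π n + ε * (π n).counter ∈ A.AccValues := by
  have hb := run_bounds A h0 hupd n π hr
  obtain ⟨γ, hi, hs⟩ := hr
  refine ⟨n, fun k => ⟨(π k).state, (π k).stack,
    (1 - ε) * posCount A π k + ε * (π k).counter⟩,
    ⟨fun k => if A.upd (π k).state (π (k+1)).state = some 1 then (1 - ε) + ε * γ k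
      else ε * γ k, ?_, ?_⟩, hf, rfl⟩
  · simp [hi, C1PVASS.init, posCount]
  · intro k hk
    obtain ⟨u, op, hd, hg, hg1, hc, hl, hst⟩ := hs k hk
    have hb1 := (hb (k+1) (by omega)).1
    have hP : posCount A π (k+1) = posCount A π k + if u = 1 then 1 else 0 := by
      simp [posCount, Finset.sum_range_succ, C1PVASS.upd, hd]
    have hU : (A.upd (π k).state (π (k+1)).state = some 1) ↔ u = 1 := by
      simp [C1PVASS.upd, hd]
    have hpos : 0 < ε * γ k := mul_pos he hg
    have hle : ε * γ k ≤ ε := by nlinarith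
    refine ⟨u, op, hd, ?_, ?_, ?_, ?_, hst⟩
    · simp only [hU]; split_ifs <;> linarith
    · simp only [hU]; split_ifs <;> linarith
    · simp only [hU, hP, hc]
      rcases hupd _ _ _ _ hd with rfl | rfl | rfl <;> norm_num <;> ring
    · simp only [h0 _, Nat.cast_zero]
      have : (0:ℝ) ≤ posCount A π (k+1) := Nat.cast_nonneg _
      have h1 : 0 ≤ 1 - ε := by linarith
      positivity

/-- If the set of final counter values of accepting runs of a 0-C1PVASS
(with counter updates in `{-1,0,+1}`) is nonempty and bounded above, then its
supremum is a natural number. -/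
theorem stmt5 {S Γ : Type} (A : C1PVASS S Γ) (h0 : A.ZeroLB) (hupd : A.UpdatesIn)
    (hne : A.AccValues.Nonempty) (hbdd : BddAbove A.AccValues) :
    ∃ m : ℕ, sSup A.AccValues = (m : ℝ) := by
  have hle : ∀ c ∈ A.AccValues, c ≤ sSup A.AccValues := fun c hc => le_csSup hbdd hc
  have key : ∀ n π, A.IsRun n π → (π n).state = A.f → ∀ ε : ℝ, 0 < ε → ε ≤ 1 →
      (1 - ε) * posCount A π n ≤ sSup A.AccValues := by
    intro n π hr hf ε he he1
    have h1 := hle _ (run_mix A h0 hupd n π hr hf ε he he1)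
    have h2 := mul_nonneg he.le (run_bounds A h0 hupd n π hr n le_rfl).1
    linarith
  have hP : ∀ n π, A.IsRun n π → (π n).state = A.f →
      (posCount A π n : ℝ) ≤ sSup A.AccValues := by
    intro n π hr hf
    have hk := key n π hr hf
    by_contra! hlt
    have hs : 0 ≤ sSup A.AccValues := by simpa using hk 1 one_pos le_rfl
    set p : ℝ := (posCount A π n : ℝ)
    set s := sSup A.AccValues
    have hp : 0 < p := by linarith
    have h := hk ((p - s) / (2 * p)) (div_pos (by linarith) (by linarith))
      (by rw [div_le_one (by linarith)]; linarith)
    have e : (1 - (p - s) / (2 * p)) * p = p - (p - s) / 2 := by field_simp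
    rw [e] at h
    linarith
  let T : Set ℕ := {p | ∃ n π, A.IsRun n π ∧ (π n).state = A.f ∧ posCount A π n = p}
  have hTne : T.Nonempty := by
    obtain ⟨c, n, π, hr, hf, _⟩ := hne
    exact ⟨_, n, π, hr, hf, rfl⟩
  have hTb : BddAbove T := by
    refine ⟨⌊sSup A.AccValues⌋₊, ?_⟩
    rintro p ⟨n, π, hr, hf, rfl⟩
    exact Nat.le_floor (hP n π hr hf)
  refine ⟨sSup T, le_antisymm (csSup_le hne ?_) ?_⟩
  · rintro c ⟨n, π, hr, hf, rfl⟩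
    refine (run_bounds A h0 hupd n π hr n le_rfl).2.trans ?_
    exact_mod_cast le_csSup hTb ⟨n, π, hr, hf, rfl⟩
  · obtain ⟨n, π, hr, hf, hm⟩ := Nat.sSup_mem hTne hTb
    rw [← hm]
    exact hP n π hr hf
end

section
/- A 0-C1PVASS with counter updates in {−1,0,+1} has an accepting run (equivalently, a 0-covering run) if and only if the underlying pushdown automaton has an accepting run in which every transition carrying counter update −1 is preceded, strictly earlier along the run, by some transition carrying counter update +1. -/
/-- A 0-C1PVASS with counter updates in `{-1,0,+1}` has an accepting run
(equivalently, a 0-covering run) iff the underlying PDA has an accepting run in which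
every `-1` transition is preceded, strictly earlier along the run, by a `+1` transition. -/
theorem stmt6 {S Γ : Type} (A : C1PVASS S Γ) (h0 : A.ZeroLB) (hupd : A.UpdatesIn) :
    (∃ n π, A.IsRun n π ∧ (π n).state = A.f) ↔
    (∃ n ρ, A.IsPDARun n ρ ∧ (ρ n).1 = A.f ∧
      ∀ i < n, A.upd (ρ i).1 (ρ (i+1)).1 = some (-1) →
        ∃ j < i, A.upd (ρ j).1 (ρ (j+1)).1 = some 1) := by
  constructor
  · rintro ⟨n, π, ⟨γ, hinit, hstep⟩, hf⟩
    refine ⟨n, fun i => ((π i).state, (π i).stack), ⟨?_, ?_⟩, hf, ?_⟩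
    · simp [hinit, C1PVASS.init]
    · intro i hi
      obtain ⟨u, op, h1, -, -, -, -, h2⟩ := hstep i hi
      exact ⟨u, op, h1, h2⟩
    · intro i hi hm
      by_contra hno
      push Not at hno
      have key : ∀ k ≤ i, (π k).counter ≤ 0 := by
        intro k
        induction k with
        | zero => intro _; simp [hinit, C1PVASS.init]
        | succ k ih =>
          intro hk
          have hc := ih (by omega)
          obtain ⟨u, op, h1, hg, -, h2, -, -⟩ := hstep k (by omega)
          have hne := hno k (by omega)
          simp only [C1PVASS.upd, h1, Option.map_some, ne_eq, Option.some.injEq] at hne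
          rw [h2]
          rcases hupd _ _ _ _ h1 with rfl | rfl | rfl
          · push_cast; linarith
          · push_cast; linarith
          · exact absurd rfl hne
      have hc := key i le_rfl
      obtain ⟨u, op, h1, hg, -, h2, h3, -⟩ := hstep i hi
      simp only [C1PVASS.upd, h1, Option.map_some, Option.some.injEq] at hm
      subst hm
      rw [h0, h2] at h3
      push_cast at h3
      linarith
  · rintro ⟨n, ρ, ⟨hinit, hstep⟩, hf, hpre⟩
    let U : ℕ → ℤ := fun k => (A.upd (ρ k).1 (ρ (k+1)).1).getD 0
    let c : ℕ → ℝ := fun i => ∑ k ∈ Finset.range i, (1/2 : ℝ)^(k+1) * (U k : ℝ)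
    have hcs : ∀ i, c (i+1) = c i + (1/2 : ℝ)^(i+1) * (U i : ℝ) := fun i =>
      Finset.sum_range_succ _ _
    have key : ∀ i ≤ n, 0 ≤ c i ∧
        ((∃ j < i, A.upd (ρ j).1 (ρ (j+1)).1 = some 1) → (1/2 : ℝ)^i ≤ c i) := by
      intro i
      induction i with
      | zero => intro _; simp [c]
      | succ i ih =>
        intro hi
        obtain ⟨hc, hp⟩ := ih (by omega)
        obtain ⟨u, op, h1, -⟩ := hstep i (by omega)
        have hu : A.upd (ρ i).1 (ρ (i+1)).1 = some u := by simp [C1PVASS.upd, h1]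
        have hU : U i = u := by simp [U, hu]
        have hpos : (0:ℝ) < (1/2 : ℝ)^i := by positivity
        rw [hcs, hU, pow_succ]
        rcases hupd _ _ _ _ h1 with rfl | rfl | rfl
        · have := hp (hpre i (by omega) hu)
          push_cast
          exact ⟨by linarith, fun _ => by linarith⟩
        · push_cast
          refine ⟨by linarith, ?_⟩
          rintro ⟨j, hj, hj1⟩
          have hne : j ≠ i := by
            rintro rfl
            rw [hu] at hj1
            simp at hj1
          have := hp ⟨j, by omega, hj1⟩
          linarith
        · push_cast
          exact ⟨by linarith, fun _ => by linarith⟩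
    refine ⟨n, fun i => ⟨(ρ i).1, (ρ i).2, c i⟩, ⟨fun i => (1/2 : ℝ)^(i+1), ?_, ?_⟩, hf⟩
    · simp [hinit, C1PVASS.init, c]
    · intro i hi
      obtain ⟨u, op, h1, h2⟩ := hstep i hi
      have hU : U i = u := by simp [U, C1PVASS.upd, h1]
      refine ⟨u, op, h1, by positivity, pow_le_one₀ (by norm_num) (by norm_num), ?_, ?_, h2⟩
      · show c (i+1) = _
        rw [hcs, hU]
      · show (A.lb (ρ (i+1)).1 : ℝ) ≤ c (i+1)
        rw [h0]
        simpa using (key (i+1) (by omega)).1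
end

section
/- A 0-C1PVASS with counter updates in {−1,0,+1} has a 0-reaching run if and only if its underlying pushdown automaton has an accepting run such that either (1) all counter updates along the run are 0, or (2) the first nonzero counter update along the run is +1 and the last nonzero counter update along the run is −1. -/
theorem num_forward (n : ℕ) (u : ℕ → ℤ) (c γ : ℕ → ℝ)
    (hu : ∀ i < n, u i = -1 ∨ u i = 0 ∨ u i = 1)
    (hc0 : c 0 = 0) (hcn : c n = 0) (hγ : ∀ i < n, 0 < γ i)
    (hs : ∀ i < n, c (i+1) = c i + γ i * (u i : ℝ))
    (hp : ∀ i < n, 0 ≤ c (i+1)) :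
    (∀ i < n, u i = 0) ∨
      ((∃ i < n, u i = 1 ∧ ∀ j < i, u j = 0) ∧
       (∃ i < n, u i = -1 ∧ ∀ j, i < j → j < n → u j = 0)) := by
  by_cases hall : ∀ i < n, u i = 0
  · exact Or.inl hall
  right
  push Not at hall
  have hpos : ∀ i ≤ n, 0 ≤ c i := by
    intro i hi
    rcases i with _ | i
    · exact hc0.ge
    · exact hp i (by omega)
  constructor
  · classical
    obtain ⟨hin, hi⟩ := Nat.find_spec hall
    have hmin : ∀ j < Nat.find hall, u j = 0 := by
      intro j hj
      by_contra h
      exact Nat.find_min hall hj ⟨by omega, h⟩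
    generalize Nat.find hall = i at *
    have hz : ∀ j ≤ i, c j = 0 := by
      intro j
      induction j with
      | zero => intro _; exact hc0
      | succ j ih =>
        intro hj
        rw [hs j (by omega), ih (by omega), hmin j (by omega)]; simp
    refine ⟨i, hin, ?_, hmin⟩
    rcases hu i hin with h | h | h
    · have h1 := hp i hin
      rw [hs i hin, hz i le_rfl, h] at h1
      have := hγ i hin
      push_cast at h1
      linarith
    · exact absurd h hi
    · exact h
  · classical
    have hall2 : ∃ k, k < n ∧ u (n - 1 - k) ≠ 0 := by
      obtain ⟨i, hi, h⟩ := hall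
      exact ⟨n - 1 - i, by omega, by rwa [show n - 1 - (n - 1 - i) = i by omega]⟩
    obtain ⟨hkn, hk⟩ := Nat.find_spec hall2
    have hmin : ∀ j < Nat.find hall2, u (n - 1 - j) = 0 := by
      intro j hj
      by_contra h
      exact Nat.find_min hall2 hj ⟨by omega, h⟩
    generalize Nat.find hall2 = k at *
    have hz : ∀ j ≤ k, c (n - j) = 0 := by
      intro j
      induction j with
      | zero => intro _; exact hcn
      | succ j ih =>
        intro hj
        have h1 := hs (n - 1 - j) (by omega)
        rw [hmin j (by omega), show n - 1 - j + 1 = n - j by omega, ih (by omega)] at h1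
        rw [show n - (j + 1) = n - 1 - j by omega]
        simpa using h1.symm
    refine ⟨n - 1 - k, by omega, ?_, ?_⟩
    · rcases hu (n - 1 - k) (by omega) with h | h | h
      · exact h
      · exact absurd h hk
      · have h1 := hs (n - 1 - k) (by omega)
        rw [show n - 1 - k + 1 = n - k by omega, hz k le_rfl, h] at h1
        have := hγ (n - 1 - k) (by omega)
        have := hpos (n - 1 - k) (by omega)
        push_cast at h1
        linarith
    · intro j h1 h2
      have := hmin (n - 1 - j) (by omega)
      rwa [show n - 1 - (n - 1 - j) = j by omega] at this

theorem num_backward (n : ℕ) (u : ℕ → ℤ)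
    (hu : ∀ i < n, u i = -1 ∨ u i = 0 ∨ u i = 1)
    (h : (∀ i < n, u i = 0) ∨
      ((∃ i < n, u i = 1 ∧ ∀ j < i, u j = 0) ∧
       (∃ i < n, u i = -1 ∧ ∀ j, i < j → j < n → u j = 0))) :
    ∃ c : ℕ → ℝ, c 0 = 0 ∧ c n = 0 ∧
      ∀ i < n, ∃ γ : ℝ, 0 < γ ∧ γ ≤ 1 ∧ c (i+1) = c i + γ * (u i : ℝ) ∧ 0 ≤ c (i+1) := by
  rcases h with h | ⟨⟨a, han, ha, ha'⟩, b, hbn, hb, hb'⟩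
  · refine ⟨fun _ => 0, rfl, rfl, fun i hi => ⟨1, one_pos, le_rfl, ?_, le_rfl⟩⟩
    simp [h i hi]
  have hab : a < b := by
    rcases lt_trichotomy a b with h | h | h
    · exact h
    · subst h; omega
    · have := ha' b h; omega
  have hw : ∀ i ≤ n, |∑ j ∈ Finset.range i, u j| ≤ (n : ℤ) := by
    have : ∀ i ≤ n, |∑ j ∈ Finset.range i, u j| ≤ (i : ℤ) := by
      intro i
      induction i with
      | zero => simp
      | succ i ih =>
        intro hi
        have h1 := ih (by omega)
        rw [Finset.sum_range_succ]
        rw [abs_le] at *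
        push_cast
        rcases hu i (by omega) with h | h | h <;> omega
    intro i hi
    have := this i hi
    omega
  have hwa : ∑ j ∈ Finset.range (a+1), u j = 1 := by
    rw [Finset.sum_range_succ, ha, Finset.sum_eq_zero]
    · rfl
    · intro j hj; exact ha' j (by simpa using hj)
  obtain ⟨w, hwdef⟩ : ∃ w : ℕ → ℤ, ∀ i, w i = ∑ j ∈ Finset.range i, u j := ⟨_, fun _ => rfl⟩
  have hws : ∀ i, w (i+1) = w i + u i := by
    intro i; rw [hwdef, hwdef, Finset.sum_range_succ]
  simp only [← hwdef] at hw hwa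
  obtain ⟨D, hD⟩ : ∃ D : ℝ, D = 2 * ((n : ℝ) + 2) := ⟨_, rfl⟩
  have hn0 : (0 : ℝ) ≤ n := Nat.cast_nonneg n
  have hDp : 0 < D := by rw [hD]; positivity
  have hbd : ∀ i ≤ n, 0 < 1/2 + ((w i : ℝ) - 1) / D ∧ 1/2 + ((w i : ℝ) - 1) / D ≤ 1 := by
    intro i hi
    have h1 := abs_le.mp (hw i hi)
    have h2 : -(n : ℝ) ≤ w i := by exact_mod_cast h1.1
    have h3 : (w i : ℝ) ≤ n := by exact_mod_cast h1.2
    have h4 : -(1/2) < ((w i : ℝ) - 1) / D := by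
      rw [lt_div_iff₀ hDp, hD]; linarith
    have h5 : ((w i : ℝ) - 1) / D ≤ 1/2 := by
      rw [div_le_iff₀ hDp, hD]; linarith
    constructor <;> linarith
  refine ⟨fun i => if i ≤ a then 0 else if i ≤ b then 1/2 + ((w i : ℝ) - 1) / D else 0,
    by simp, ?_, ?_⟩
  · simp [show ¬ n ≤ a by omega, show ¬ n ≤ b by omega]
  intro i hi
  simp only
  rcases lt_trichotomy i a with h | h | h
  · refine ⟨1, one_pos, le_rfl, ?_, ?_⟩
    · simp [show i + 1 ≤ a by omega, h.le, ha' i h]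
    · simp [show i + 1 ≤ a by omega]
  · subst h
    refine ⟨1/2, by norm_num, by norm_num, ?_, ?_⟩
    · rw [if_neg (by omega), if_pos (by omega), if_pos le_rfl, hwa, ha]; simp
    · rw [if_neg (by omega), if_pos (by omega)]; exact (hbd _ (by omega)).1.le
  rcases lt_trichotomy i b with h2 | h2 | h2
  · refine ⟨1/D, by positivity, ?_, ?_, ?_⟩
    · rw [div_le_iff₀ hDp, hD]; linarith
    · rw [if_neg (by omega), if_pos (by omega), if_neg (by omega), if_pos (by omega), hws]
      push_cast; ring
    · rw [if_neg (by omega), if_pos (by omega)]; exact (hbd _ (by omega)).1.le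
  · subst h2
    refine ⟨_, (hbd i hi.le).1, (hbd i hi.le).2, ?_, ?_⟩
    · rw [if_neg (by omega), if_neg (by omega), if_neg (by omega), if_pos le_rfl, hb]
      push_cast; ring
    · rw [if_neg (by omega), if_neg (by omega)]
  · refine ⟨1, one_pos, le_rfl, ?_, ?_⟩
    · rw [if_neg (by omega), if_neg (by omega), if_neg (by omega), if_neg (by omega), hb' i h2 hi]
      simp
    · rw [if_neg (by omega), if_neg (by omega)]

/-- A 0-C1PVASS with counter updates in `{-1,0,+1}` has a 0-reaching run
iff its underlying PDA has an accepting run such that either (1) all counter updates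
along the run are `0`, or (2) the first nonzero counter update along the run is `+1`
and the last nonzero counter update along the run is `-1`. -/
theorem stmt7 {S Γ : Type} (A : C1PVASS S Γ) (h0 : A.ZeroLB) (hupd : A.UpdatesIn) :
    (∃ n π, A.IsRun n π ∧ (π n).state = A.f ∧ (π n).counter = 0) ↔
    (∃ n ρ, A.IsPDARun n ρ ∧ (ρ n).1 = A.f ∧
      ((∀ i < n, A.upd (ρ i).1 (ρ (i+1)).1 = some 0) ∨
       ((∃ i < n, A.upd (ρ i).1 (ρ (i+1)).1 = some 1 ∧
           ∀ j < i, A.upd (ρ j).1 (ρ (j+1)).1 = some 0) ∧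
        (∃ i < n, A.upd (ρ i).1 (ρ (i+1)).1 = some (-1) ∧
           ∀ j, i < j → j < n → A.upd (ρ j).1 (ρ (j+1)).1 = some 0)))) := by
  constructor
  · rintro ⟨n, π, ⟨γ, hinit, hstep⟩, hf, hc⟩
    choose! u op hδ hγ0 _ hcn hlb hst using hstep
    have hU : ∀ i < n, A.upd (π i).state (π (i+1)).state = some (u i) := by
      intro i hi; simp [C1PVASS.upd, hδ i hi]
    refine ⟨n, fun i => ((π i).state, (π i).stack),
      ⟨by simp [hinit, C1PVASS.init], fun i hi => ⟨u i, op i, hδ i hi, hst i hi⟩⟩, hf, ?_⟩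
    have key := num_forward n u (fun i => (π i).counter) γ
      (fun i hi => hupd _ _ _ _ (hδ i hi)) (by simp [hinit, C1PVASS.init]) hc hγ0 hcn
      (fun i hi => by have := hlb i hi; rw [h0] at this; simpa using this)
    simp only
    rcases key with h | ⟨⟨a, ha, h1, h2⟩, b, hb, h3, h4⟩
    · left; intro i hi; rw [hU i hi, h i hi]
    · right
      refine ⟨⟨a, ha, by rw [hU a ha, h1], fun j hj => ?_⟩,
        b, hb, by rw [hU b hb, h3], fun j hj hj' => ?_⟩
      · rw [hU j (by omega), h2 j hj]
      · rw [hU j hj', h4 j hj hj']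
  · rintro ⟨n, ρ, ⟨hinit, hstep⟩, hf, hcond⟩
    choose! u op hδ hst using hstep
    have hU : ∀ i < n, ∀ v, A.upd (ρ i).1 (ρ (i+1)).1 = some v → u i = v := by
      intro i hi v hv; simpa [C1PVASS.upd, hδ i hi] using hv
    obtain ⟨c, hc0, hcn, hc⟩ := num_backward n u (fun i hi => hupd _ _ _ _ (hδ i hi)) (by
      rcases hcond with h | ⟨⟨a, ha, h1, h2⟩, b, hb, h3, h4⟩
      · left; exact fun i hi => hU i hi _ (h i hi)
      · right
        exact ⟨⟨a, ha, hU a ha _ h1, fun j hj => hU j (by omega) _ (h2 j hj)⟩,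
          b, hb, hU b hb _ h3, fun j hj hj' => hU j hj' _ (h4 j hj hj')⟩)
    choose! γ hγ0 hγ1 hγ2 hγ3 using hc
    refine ⟨n, fun i => ⟨(ρ i).1, (ρ i).2, c i⟩, ⟨γ, ?_, fun i hi => ?_⟩, hf, hcn⟩
    · simp [hinit, hc0, C1PVASS.init]
    · refine ⟨u i, op i, hδ i hi, hγ0 i hi, hγ1 i hi, hγ2 i hi, ?_, hst i hi⟩
      rw [h0]; simpa using hγ3 i hi
end

section
/- Let ρ be an accepting run of the underlying pushdown automaton of a 0-C1PVASS with counter updates in {−1,0,+1}, having exactly m transitions with update +1, and such that every transition with update −1 is preceded strictly earlier along ρ by some transition with update +1. Then: (i) every run of the 0-C1PVASS following the same sequence of transitions as ρ has final counter value at most m; (ii) for every ε ∈ (0,1) there is a run of the 0-C1PVASS following ρ with final counter value strictly greater than m − ε; and (iii) if ρ contains no transition with update −1, there is a run following ρ with final counter value exactly m. -/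
theorem stmt8_build {S Γ : Type} (A : C1PVASS S Γ) (h0 : A.ZeroLB) (hupd : A.UpdatesIn)
    (n : ℕ) (ρ : ℕ → S × List Γ)
    (hρ : A.IsPDARun n ρ)
    (hprec : ∀ i < n, A.upd (ρ i).1 (ρ (i+1)).1 = some (-1) →
      ∃ j < i, A.upd (ρ j).1 (ρ (j+1)).1 = some 1)
    (d : ℝ) (hd : 0 < d) (hd1 : d ≤ 1) (hdn : d * n ≤ 1) :
    ∃ π : ℕ → Config S Γ, A.IsRun n π ∧
      (∀ i ≤ n, (π i).state = (ρ i).1 ∧ (π i).stack = (ρ i).2) ∧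
      (π n).counter = ∑ i ∈ Finset.range n,
        (if A.upd (ρ i).1 (ρ (i+1)).1 = some 1 then (1 : ℝ)
          else if A.upd (ρ i).1 (ρ (i+1)).1 = some (-1) then -d else 0) := by
  set w : ℕ → ℝ := fun i => (if A.upd (ρ i).1 (ρ (i+1)).1 = some 1 then (1 : ℝ)
          else if A.upd (ρ i).1 (ρ (i+1)).1 = some (-1) then -d else 0) with hw
  have hwd : ∀ i, -d ≤ w i := by
    intro i
    simp only [hw]
    split_ifs <;> linarith
  have hnn : ∀ k ≤ n, 0 ≤ ∑ i ∈ Finset.range k, w i := by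
    intro k hk
    by_cases hex : ∃ j < k, A.upd (ρ j).1 (ρ (j+1)).1 = some 1
    · obtain ⟨j, hj, hj1⟩ := hex
      have hjm : j ∈ Finset.range k := Finset.mem_range.2 hj
      rw [← Finset.add_sum_erase _ _ hjm]
      have h1 : w j = 1 := by simp [hw, hj1]
      have h2 : ∑ i ∈ (Finset.range k).erase j, (-d) ≤ ∑ i ∈ (Finset.range k).erase j, w i :=
        Finset.sum_le_sum fun i _ => hwd i
      rw [Finset.sum_const, nsmul_eq_mul] at h2
      have h3 : (((Finset.range k).erase j).card : ℝ) ≤ n := by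
        have := Finset.card_erase_le (s := Finset.range k) (a := j)
        rw [Finset.card_range] at this
        exact_mod_cast this.trans hk
      have h4 : d * (((Finset.range k).erase j).card : ℝ) ≤ d * n :=
        mul_le_mul_of_nonneg_left h3 hd.le
      linarith
    · apply Finset.sum_nonneg
      intro i hi
      have hi := Finset.mem_range.1 hi
      simp only [hw]
      split_ifs with h1 h2
      · norm_num
      · obtain ⟨j, hj, hj1⟩ := hprec i (by omega) h2
        exact absurd ⟨j, by omega, hj1⟩ hex
      · exact le_rfl
  refine ⟨fun i => ⟨(ρ i).1, (ρ i).2, ∑ j ∈ Finset.range i, w j⟩,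
    ⟨fun i => if A.upd (ρ i).1 (ρ (i+1)).1 = some (-1) then d else 1, ?_, ?_⟩,
    fun i _ => ⟨rfl, rfl⟩, rfl⟩
  · simp [C1PVASS.init, hρ.1]
  · intro i hi
    obtain ⟨u, op, hδ, hs⟩ := hρ.2 i hi
    have hu : A.upd (ρ i).1 (ρ (i+1)).1 = some u := by simp [C1PVASS.upd, hδ]
    refine ⟨u, op, hδ, ?_, ?_, ?_, ?_, hs⟩
    · dsimp only; split_ifs <;> linarith
    · dsimp only; split_ifs <;> linarith
    · dsimp only
      rw [Finset.sum_range_succ]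
      simp only [hw, hu]
      rcases hupd _ _ _ _ hδ with rfl | rfl | rfl <;> simp
    · dsimp only
      rw [h0]
      simpa using hnn (i+1) hi

/-- Let `ρ` be an accepting run of the underlying PDA of a 0-C1PVASS with
counter updates in `{-1,0,+1}`, with exactly `m` transitions of update `+1`, in which
every `-1` transition is preceded strictly earlier by a `+1` transition.  Then:
(i) every run of the 0-C1PVASS following the same sequence of transitions as `ρ`
has final counter value at most `m`;
(ii) for every `ε ∈ (0,1)` there is a run of the 0-C1PVASS following `ρ` with final
counter value strictly greater than `m - ε`; and
(iii) if `ρ` contains no `-1` transition, there is a run following `ρ` with final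
counter value exactly `m`. -/
theorem stmt8 {S Γ : Type} (A : C1PVASS S Γ) (h0 : A.ZeroLB) (hupd : A.UpdatesIn)
    (n : ℕ) (ρ : ℕ → S × List Γ) (m : ℕ)
    (hρ : A.IsPDARun n ρ) (hacc : (ρ n).1 = A.f)
    (hm : ((Finset.range n).filter
      (fun i => A.upd (ρ i).1 (ρ (i+1)).1 = some 1)).card = m)
    (hprec : ∀ i < n, A.upd (ρ i).1 (ρ (i+1)).1 = some (-1) →
      ∃ j < i, A.upd (ρ j).1 (ρ (j+1)).1 = some 1) :
    (∀ π : ℕ → Config S Γ, A.IsRun n π → (∀ i ≤ n, (π i).state = (ρ i).1) →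
      (π n).counter ≤ (m : ℝ)) ∧
    (∀ ε : ℝ, 0 < ε → ε < 1 → ∃ π : ℕ → Config S Γ, A.IsRun n π ∧
      (∀ i ≤ n, (π i).state = (ρ i).1 ∧ (π i).stack = (ρ i).2) ∧
      (m : ℝ) - ε < (π n).counter) ∧
    ((∀ i < n, A.upd (ρ i).1 (ρ (i+1)).1 ≠ some (-1)) →
      ∃ π : ℕ → Config S Γ, A.IsRun n π ∧
        (∀ i ≤ n, (π i).state = (ρ i).1 ∧ (π i).stack = (ρ i).2) ∧
        (π n).counter = (m : ℝ)) := by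
  have hm' : (m : ℝ) = ∑ i ∈ Finset.range n,
      (if A.upd (ρ i).1 (ρ (i+1)).1 = some 1 then (1 : ℝ) else 0) := by
    rw [← hm, Finset.sum_boole]
  refine ⟨?_, ?_, ?_⟩
  · rintro π ⟨γ, hi, hstep⟩ hst
    have key : ∀ k ≤ n, (π k).counter ≤ ∑ i ∈ Finset.range k,
        (if A.upd (ρ i).1 (ρ (i+1)).1 = some 1 then (1 : ℝ) else 0) := by
      intro k
      induction k with
      | zero => intro _; simp [hi, C1PVASS.init]
      | succ k ih =>
        intro hk
        obtain ⟨u, op, hδ, hg, hg1, hc, -, -⟩ := hstep k (by omega)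
        rw [hst k (by omega), hst (k+1) hk] at hδ
        have hu : A.upd (ρ k).1 (ρ (k+1)).1 = some u := by simp [C1PVASS.upd, hδ]
        have := ih (by omega)
        rw [Finset.sum_range_succ, hc, hu]
        rcases hupd _ _ _ _ hδ with rfl | rfl | rfl <;> simp [-Finset.sum_boole] <;> linarith
    rw [hm']
    exact key n le_rfl
  · intro ε hε hε1
    have hn : (0 : ℝ) < n + 1 := by positivity
    have hdn : ε / (n + 1) * n < ε := by
      rw [div_mul_eq_mul_div, div_lt_iff₀ hn]
      linarith
    have hd0 : 0 < ε / (n + 1) := by positivity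
    obtain ⟨π, h1, h2, h3⟩ := stmt8_build A h0 hupd n ρ hρ hprec (ε / (n+1)) hd0
      (by rw [div_le_one hn]; have : (0 : ℝ) ≤ n := by positivity
          linarith) (by linarith)
    refine ⟨π, h1, h2, ?_⟩
    rw [h3, hm']
    have h4 : ∑ i ∈ Finset.range n,
        ((if A.upd (ρ i).1 (ρ (i+1)).1 = some 1 then (1 : ℝ) else 0) - ε / (n+1)) ≤
        ∑ i ∈ Finset.range n,
        (if A.upd (ρ i).1 (ρ (i+1)).1 = some 1 then (1 : ℝ)
          else if A.upd (ρ i).1 (ρ (i+1)).1 = some (-1) then -(ε / (n+1)) else 0) := by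
      apply Finset.sum_le_sum
      intro i _
      split_ifs <;> linarith
    rw [Finset.sum_sub_distrib, Finset.sum_const, Finset.card_range, nsmul_eq_mul] at h4
    linarith
  · intro hno
    have hn : (0 : ℝ) < n + 1 := by positivity
    have hn' : (0 : ℝ) ≤ n := by positivity
    obtain ⟨π, h1, h2, h3⟩ := stmt8_build A h0 hupd n ρ hρ hprec (1 / (n+1)) (by positivity)
      (by rw [div_le_one hn]; linarith)
      (by rw [div_mul_eq_mul_div, div_le_one hn]; linarith)
    refine ⟨π, h1, h2, ?_⟩
    rw [h3, hm']
    apply Finset.sum_congr rfl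
    intro i hi
    rw [if_neg (hno i (Finset.mem_range.1 hi))]
end

section
/- For a 0-C1PVASS with counter updates in {−1,0,+1}, the set of final counter values of accepting runs is bounded above if and only if the set of natural numbers m such that the underlying pushdown automaton has an accepting run with exactly m transitions of update +1 in which every transition of update −1 is preceded by a transition of update +1, is finite; moreover, if this set of natural numbers is nonempty with maximum p, then the supremum of the final counter values of accepting runs equals p. -/
/-- The set of natural numbers `m` such that the underlying PDA of `A` has an
accepting run with exactly `m` transitions of update `+1` in which every `-1`
transition is preceded strictly earlier by a `+1` transition. -/
def goodCounts {S Γ : Type} (A : C1PVASS S Γ) : Set ℕ :=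
  {m | ∃ n ρ, A.IsPDARun n ρ ∧ (ρ n).1 = A.f ∧
    (∀ i < n, A.upd (ρ i).1 (ρ (i+1)).1 = some (-1) →
      ∃ j < i, A.upd (ρ j).1 (ρ (j+1)).1 = some 1) ∧
    ((Finset.range n).filter
      (fun i => A.upd (ρ i).1 (ρ (i+1)).1 = some 1)).card = m}

/-- Number of `+1` transitions among the first `i` ones. -/
def plusCount {S Γ : Type} (A : C1PVASS S Γ) (σ : ℕ → S) (i : ℕ) : ℕ :=
  ((Finset.range i).filter (fun k => A.upd (σ k) (σ (k+1)) = some 1)).card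

lemma plusCount_succ {S Γ : Type} (A : C1PVASS S Γ) (σ : ℕ → S) (i : ℕ) :
    plusCount A σ (i+1) =
      plusCount A σ i + if A.upd (σ i) (σ (i+1)) = some 1 then 1 else 0 := by
  unfold plusCount
  rw [Finset.range_add_one, Finset.filter_insert]
  split_ifs with h
  · rw [Finset.card_insert_of_notMem (by simp)]
  · simp

lemma plusCount_pos {S Γ : Type} (A : C1PVASS S Γ) (σ : ℕ → S) (i : ℕ) :
    0 < plusCount A σ i ↔ ∃ j < i, A.upd (σ j) (σ (j+1)) = some 1 := by
  unfold plusCount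
  rw [Finset.card_pos]
  constructor
  · rintro ⟨j, hj⟩
    simp only [Finset.mem_filter, Finset.mem_range] at hj
    exact ⟨j, hj⟩
  · rintro ⟨j, hj⟩
    exact ⟨j, by simpa using hj⟩

lemma acc_le_good {S Γ : Type} (A : C1PVASS S Γ) (h0 : A.ZeroLB) (hupd : A.UpdatesIn)
    (c : ℝ) (hc : c ∈ A.AccValues) : ∃ m ∈ goodCounts A, c ≤ (m : ℝ) := by
  obtain ⟨n, π, ⟨γ, start_eq, hstep⟩, hf, rfl⟩ := hc
  have inv : ∀ i ≤ n, (π i).counter ≤ (plusCount A (fun k => (π k).state) i : ℝ) := by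
    intro i
    induction i with
    | zero => intro _; rw [start_eq]; simp [C1PVASS.init]
    | succ i ih =>
      intro hi
      have ih := ih (by omega)
      obtain ⟨u, op, hδ, hg0, hg1, hcnt, hlb, -⟩ := hstep i (by omega)
      rw [plusCount_succ, hcnt]
      have hu : A.upd (π i).state (π (i+1)).state = some u := by simp [C1PVASS.upd, hδ]
      rw [hu]
      push_cast
      rcases hupd _ _ _ _ hδ with rfl | rfl | rfl
      · simp; linarith
      · simp; linarith
      · simp; linarith
  refine ⟨plusCount A (fun k => (π k).state) n,
    ⟨n, fun k => ((π k).state, (π k).stack), ⟨?_, ?_⟩, hf, ?_, rfl⟩, inv n le_rfl⟩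
  · simp [start_eq, C1PVASS.init]
  · intro i hi
    obtain ⟨u, op, hδ, -, -, -, -, hs⟩ := hstep i hi
    exact ⟨u, op, hδ, hs⟩
  · intro i hi hm
    obtain ⟨u, op, hδ, hg0, hg1, hcnt, hlb, -⟩ := hstep i hi
    have hu : A.upd (π i).state (π (i+1)).state = some u := by simp [C1PVASS.upd, hδ]
    have hm' : A.upd (π i).state (π (i+1)).state = some (-1) := hm
    rw [hu] at hm'
    obtain rfl : u = -1 := by simpa using hm'
    rw [h0] at hlb
    push_cast at hlb hcnt
    have h1 := inv i hi.le
    have h2 : (0 : ℝ) < (plusCount A (fun k => (π k).state) i : ℝ) := by linarith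
    exact (plusCount_pos A (fun k => (π k).state) i).1 (by exact_mod_cast h2)

lemma good_approx {S Γ : Type} (A : C1PVASS S Γ) (h0 : A.ZeroLB) (hupd : A.UpdatesIn)
    (m : ℕ) (hm : m ∈ goodCounts A) (ε : ℝ) (hε : 0 < ε) (hε1 : ε ≤ 1) :
    ∃ c ∈ A.AccValues, (m : ℝ) - ε ≤ c := by
  obtain ⟨n, ρ, ⟨start_eq, hstep⟩, hf, hgood, hcard⟩ := hm
  obtain ⟨e, he⟩ : ∃ e : ℝ, e = ε / (n + 1) := ⟨_, rfl⟩
  have hn : (0 : ℝ) < (n : ℝ) + 1 := by positivity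
  have he0 : 0 < e := by rw [he]; positivity
  have hne : (n : ℝ) * e + e = ε := by rw [he]; field_simp
  have hn0 : (0 : ℝ) ≤ (n : ℝ) * e := by positivity
  have he1 : e ≤ 1 := by linarith
  let u : ℕ → ℤ := fun i => (A.upd (ρ i).1 (ρ (i+1)).1).getD 0
  let g : ℕ → ℝ := fun i => if u i = -1 then e else 1
  let C : ℕ → ℝ := fun i => ∑ j ∈ Finset.range i, g j * (u j : ℝ)
  have hC : ∀ i, C (i+1) = C i + g i * (u i : ℝ) := fun i => Finset.sum_range_succ _ _
  let P : ℕ → ℕ := plusCount A (fun k => (ρ k).1)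
  have inv : ∀ i ≤ n, (P i : ℝ) - i * e ≤ C i ∧ (P i = 0 → C i = 0) := by
    intro i
    induction i with
    | zero => intro _; simp [C, P, plusCount]
    | succ i ih =>
      intro hi
      obtain ⟨ih1, ih2⟩ := ih (by omega)
      obtain ⟨v, op, hδ, -⟩ := hstep i (by omega)
      have hv : A.upd (ρ i).1 (ρ (i+1)).1 = some v := by simp [C1PVASS.upd, hδ]
      have huv : u i = v := by simp [u, hv]
      have hP : P (i+1) = P i + if v = 1 then 1 else 0 := by
        have := plusCount_succ A (fun k => (ρ k).1) i
        simp only [hv, Option.some.injEq] at this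
        exact this
      rw [hC, hP]
      simp only [g, huv]
      rcases hupd _ _ _ _ hδ with rfl | rfl | rfl
      · have hpos : 0 < P i :=
          (plusCount_pos A (fun k => (ρ k).1) i).2 (hgood i (by omega) hv)
        constructor
        · simp; linarith
        · intro h; simp at h; omega
      · constructor
        · simp; linarith
        · intro h; simp at h; simp [ih2 h]
      · constructor
        · simp; linarith
        · intro h; simp at h
  have hnonneg : ∀ i ≤ n, 0 ≤ C i := by
    intro i hi
    obtain ⟨h1, h2⟩ := inv i hi
    rcases Nat.eq_zero_or_pos (P i) with h | h
    · rw [h2 h]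
    · have h3 : (1 : ℝ) ≤ P i := by exact_mod_cast h
      have h4 : (i : ℝ) * e ≤ n * e := by gcongr
      linarith
  refine ⟨C n, ⟨n, fun i => ⟨(ρ i).1, (ρ i).2, C i⟩, ⟨g, ?_, ?_⟩, hf, rfl⟩, ?_⟩
  · simp [C1PVASS.init, start_eq, C]
  · intro i hi
    obtain ⟨v, op, hδ, hs⟩ := hstep i hi
    have hv : A.upd (ρ i).1 (ρ (i+1)).1 = some v := by simp [C1PVASS.upd, hδ]
    have huv : u i = v := by simp [u, hv]
    refine ⟨v, op, hδ, ?_, ?_, ?_, ?_, hs⟩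
    · simp only [g]; split_ifs <;> linarith
    · simp only [g]; split_ifs <;> linarith
    · have := hC i
      rw [huv] at this
      exact this
    · rw [h0]
      simpa using hnonneg (i+1) hi
  · have h1 := (inv n le_rfl).1
    have h2 : P n = m := hcard
    rw [h2] at h1
    linarith

/-- For a 0-C1PVASS with counter updates in `{-1,0,+1}`, the set of
final counter values of accepting runs is bounded above iff `goodCounts A` is finite;
moreover, if `goodCounts A` is nonempty with maximum `p`, then the supremum of the
final counter values of accepting runs equals `p`. -/
theorem stmt9 {S Γ : Type} (A : C1PVASS S Γ) (h0 : A.ZeroLB) (hupd : A.UpdatesIn) :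
    (BddAbove A.AccValues ↔ (goodCounts A).Finite) ∧
    (∀ p : ℕ, p ∈ goodCounts A → (∀ m ∈ goodCounts A, m ≤ p) →
      sSup A.AccValues = (p : ℝ)) := by
  refine ⟨⟨?_, ?_⟩, ?_⟩
  · rintro ⟨B, hB⟩
    refine (Set.finite_Iic ⌊B + 1⌋₊).subset ?_
    intro m hm
    obtain ⟨c, hc, hmc⟩ := good_approx A h0 hupd m hm 1 one_pos le_rfl
    exact Nat.le_floor (by have := hB hc; linarith)
  · intro hfin
    obtain ⟨b, hb⟩ := hfin.bddAbove
    refine ⟨b, fun c hc => ?_⟩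
    obtain ⟨m, hm, hcm⟩ := acc_le_good A h0 hupd c hc
    have : (m : ℝ) ≤ b := by exact_mod_cast hb hm
    linarith
  · intro p hp hmax
    refine IsLUB.csSup_eq ⟨?_, ?_⟩ ?_
    · intro c hc
      obtain ⟨m, hm, hcm⟩ := acc_le_good A h0 hupd c hc
      have : (m : ℝ) ≤ p := by exact_mod_cast hmax m hm
      linarith
    · intro b hb
      refine le_of_forall_pos_le_add fun ε hε => ?_
      obtain ⟨c, hc, h⟩ := good_approx A h0 hupd p hp (min ε 1) (by positivity)
        (min_le_right _ _)
      have h1 := hb hc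
      have h2 := min_le_left ε 1
      linarith
    · obtain ⟨c, hc, -⟩ := good_approx A h0 hupd p hp 1 one_pos le_rfl
      exact ⟨c, hc⟩
end

section
/- Let A be a 0-C1PVASS with counter updates in {−1,0,+1} whose set of final counter values of accepting runs is nonempty and bounded above with supremum b (a natural number). Then b is itself the final counter value of some accepting run of A if and only if the underlying pushdown automaton of A has an accepting run with exactly b transitions of update +1 and no transitions of update −1. -/
namespace C1PVASS

/-- Changing one scaling factor so that the effect strictly grows gives a larger value. -/
theorem improve {S Γ : Type} (A : C1PVASS S Γ) (h0 : A.ZeroLB) (n : ℕ)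
    (π : ℕ → Config S Γ) (γ : ℕ → ℝ) (hrun : A.IsRunWith n π γ)
    (hacc : (π n).state = A.f) (j : ℕ) (hj : j < n) (u : ℤ) (op : Option (StackOp Γ))
    (hu : A.δ (π j).state (π (j+1)).state = some (u, op)) (g : ℝ) (hg0 : 0 < g) (hg1 : g ≤ 1)
    (hlt : 0 < (g - γ j) * (u : ℝ)) :
    (π n).counter + (g - γ j) * (u : ℝ) ∈ A.AccValues := by
  obtain ⟨hinit, hstep⟩ := hrun
  refine ⟨n, fun i => ⟨(π i).state, (π i).stack,
    (π i).counter + if j < i then (g - γ j) * (u : ℝ) else 0⟩,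
    ⟨fun i => if i = j then g else γ i, ?_, ?_⟩, hacc, by simp [hj]⟩
  · simp [hinit, init]
  · intro i hi
    obtain ⟨u', op', h1, h2, h3, h4, h5, h6⟩ := hstep i hi
    refine ⟨u', op', h1, ?_, ?_, ?_, ?_, h6⟩
    · dsimp only; split_ifs <;> assumption
    · dsimp only; split_ifs <;> assumption
    · dsimp only
      rw [h4]
      rcases lt_trichotomy i j with h | h | h
      · rw [if_neg (by omega), if_neg (by omega), if_neg (by omega)]; ring
      · subst h
        rw [h1] at hu
        simp only [Option.some.injEq, Prod.mk.injEq] at hu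
        rw [if_pos (by omega), if_neg (by omega), if_pos rfl, hu.1]; ring
      · rw [if_pos (by omega), if_pos (by omega), if_neg (by omega)]; ring
    · dsimp only
      split_ifs <;> linarith

end C1PVASS

/-- Let `A` be a 0-C1PVASS with counter updates in `{-1,0,+1}` whose set
of final counter values of accepting runs is nonempty and bounded above with supremum
`b` (a natural number).  Then `b` is itself the final counter value of some accepting
run of `A` iff the underlying PDA of `A` has an accepting run with exactly `b`
transitions of update `+1` and no transitions of update `-1`. -/
theorem stmt10 {S Γ : Type} (A : C1PVASS S Γ) (h0 : A.ZeroLB) (hupd : A.UpdatesIn)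
    (b : ℕ) (hne : A.AccValues.Nonempty) (hbdd : BddAbove A.AccValues)
    (hb : sSup A.AccValues = (b : ℝ)) :
    ((b : ℝ) ∈ A.AccValues) ↔
    (∃ n ρ, A.IsPDARun n ρ ∧ (ρ n).1 = A.f ∧
      ((Finset.range n).filter
        (fun i => A.upd (ρ i).1 (ρ (i+1)).1 = some 1)).card = b ∧
      ∀ i < n, A.upd (ρ i).1 (ρ (i+1)).1 ≠ some (-1)) := by
  constructor
  · rintro ⟨n, π, ⟨γ, hrun⟩, hacc, hc⟩
    have key : ∀ j < n, ∀ u op, A.δ (π j).state (π (j+1)).state = some (u, op) →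
        ∀ g : ℝ, 0 < g → g ≤ 1 → ¬ 0 < (g - γ j) * (u : ℝ) := by
      intro j hj u op hu g hg0 hg1 hlt
      have := le_csSup hbdd (A.improve h0 n π γ hrun hacc j hj u op hu g hg0 hg1 hlt)
      rw [hb, hc] at this
      linarith
    obtain ⟨hinit, hstep⟩ := hrun
    have hno : ∀ i < n, A.upd (π i).state (π (i+1)).state ≠ some (-1) := by
      intro i hi h
      obtain ⟨u, op, h1, h2, h3, -⟩ := hstep i hi
      simp only [C1PVASS.upd, h1, Option.map_some, Option.some.injEq] at h
      refine key i hi u op h1 (γ i / 2) (by linarith) (by linarith) ?_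
      rw [h]; push_cast; linarith
    have hcount : ∀ m ≤ n, (π m).counter = (((Finset.range m).filter
        (fun i => A.upd (π i).state (π (i+1)).state = some 1)).card : ℝ) := by
      intro m
      induction m with
      | zero => intro _; simp [hinit, C1PVASS.init]
      | succ m ih =>
        intro hm
        obtain ⟨u, op, h1, h2, h3, h4, -⟩ := hstep m (by omega)
        have hu : A.upd (π m).state (π (m+1)).state = some u := by simp [C1PVASS.upd, h1]
        rw [Finset.range_add_one, Finset.filter_insert, h4, ih (by omega)]
        rcases hupd _ _ _ _ h1 with h | h | h
        · exact absurd (h ▸ hu) (hno m (by omega))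
        · rw [if_neg (by rw [hu, h]; simp), h]; simp
        · rw [if_pos (by rw [hu, h]), Finset.card_insert_of_notMem (by simp)]
          have hγ : γ m = 1 := by
            by_contra hne1
            have hlt : γ m < 1 := lt_of_le_of_ne h3 hne1
            refine key m (by omega) u op h1 1 one_pos le_rfl ?_
            rw [h]; push_cast; linarith
          rw [h, hγ]; push_cast; ring
    refine ⟨n, fun i => ((π i).state, (π i).stack), ⟨by simp [hinit, C1PVASS.init], ?_⟩,
      hacc, ?_, hno⟩
    · intro i hi
      obtain ⟨u, op, h1, -, -, -, -, h6⟩ := hstep i hi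
      exact ⟨u, op, h1, h6⟩
    · have := hcount n le_rfl
      rw [hc] at this
      exact_mod_cast this.symm
  · rintro ⟨n, ρ, ⟨hinit, hstep⟩, hacc, hcard, hno⟩
    refine ⟨n, fun m => ⟨(ρ m).1, (ρ m).2, (((Finset.range m).filter
        (fun i => A.upd (ρ i).1 (ρ (i+1)).1 = some 1)).card : ℝ)⟩, ⟨fun _ => 1, ?_, ?_⟩,
        hacc, by simp only [hcard]⟩
    · simp [hinit, C1PVASS.init]
    · intro m hm
      obtain ⟨u, op, h1, h6⟩ := hstep m hm
      have hu : A.upd (ρ m).1 (ρ (m+1)).1 = some u := by simp [C1PVASS.upd, h1]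
      refine ⟨u, op, h1, one_pos, le_rfl, ?_, ?_, h6⟩
      · dsimp only
        rw [Finset.range_add_one, Finset.filter_insert]
        rcases hupd _ _ _ _ h1 with h | h | h
        · exact absurd (h ▸ hu) (hno m hm)
        · rw [if_neg (by rw [hu, h]; simp), h]; simp
        · rw [if_pos (by rw [hu, h]), Finset.card_insert_of_notMem (by simp), h]
          push_cast; ring
      · simp [h0 _]
end

section
/- Let G be a context-free grammar in Chomsky normal form (every production is of the form A → BC with B, C variables, or A → a with a a terminal) such that no variable derives, in one or more derivation steps, a sentential form containing that same variable. Then every terminal word in the language of G has length at most 2^{|V|}, where |V| is the number of variables of G. -/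
/-- A context-free grammar is in Chomsky normal form if every production has the
form `A → BC` with `B`, `C` variables, or `A → a` with `a` a terminal. -/
def IsCNF {T : Type} (g : ContextFreeGrammar T) : Prop :=
  ∀ r ∈ g.rules,
    (∃ B C : g.NT, r.output = [Symbol.nonterminal B, Symbol.nonterminal C]) ∨
    (∃ a : T, r.output = [Symbol.terminal a])

/-- Variables occurring in a form derived from `A` in at least one step. -/
def reachSet {T : Type} (g : ContextFreeGrammar T) (A : g.NT) : Set g.NT :=
  {B | ∃ v u : List (Symbol T g.NT),
      g.Produces [Symbol.nonterminal A] v ∧ g.Derives v u ∧ Symbol.nonterminal B ∈ u}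

/-- Weight of a symbol: an upper bound for the length of the words derived from it. -/
noncomputable def symWeight {T : Type} (g : ContextFreeGrammar T) : Symbol T g.NT → ℕ
  | Symbol.terminal _ => 1
  | Symbol.nonterminal A => 2 ^ (reachSet g A).ncard

lemma reachSet_lt {T : Type} (g : ContextFreeGrammar T) [Finite g.NT]
    (hnoself : ∀ A : g.NT, A ∉ reachSet g A) (r : ContextFreeRule T g.NT) (hr : r ∈ g.rules)
    (B : g.NT) (hB : Symbol.nonterminal B ∈ r.output) :
    (reachSet g B).ncard < (reachSet g r.input).ncard := by
  have hp : g.Produces [Symbol.nonterminal r.input] r.output :=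
    ⟨r, hr, ContextFreeRule.Rewrites.input_output⟩
  apply Set.ncard_lt_ncard _ (Set.toFinite _)
  rw [Set.ssubset_iff_of_subset]
  · exact ⟨B, ⟨_, _, hp, ContextFreeGrammar.Derives.refl _, hB⟩, hnoself B⟩
  · rintro D ⟨v, u, hv, hu, hD⟩
    obtain ⟨p, q, hpq⟩ := List.append_of_mem hB
    refine ⟨r.output, p ++ (u ++ q), hp, ?_, by simp [hD]⟩
    have h := ((hv.trans_derives hu).append_right q).append_left p
    rw [hpq]
    simpa using h

lemma weight_produces {T : Type} (g : ContextFreeGrammar T) [Finite g.NT] (hcnf : IsCNF g)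
    (hnoself : ∀ A : g.NT, A ∉ reachSet g A) {u v : List (Symbol T g.NT)}
    (h : g.Produces u v) : (v.map (symWeight g)).sum ≤ (u.map (symWeight g)).sum := by
  obtain ⟨r, hr, h⟩ := h
  obtain ⟨p, q, rfl, rfl⟩ := h.exists_parts
  have key : (r.output.map (symWeight g)).sum ≤ symWeight g (Symbol.nonterminal r.input) := by
    rcases hcnf r hr with ⟨B, C, ho⟩ | ⟨a, ho⟩
    · have hB := reachSet_lt g hnoself r hr B (by simp [ho])
      have hC := reachSet_lt g hnoself r hr C (by simp [ho])
      have h1 : 2 ^ ((reachSet g B).ncard + 1) ≤ 2 ^ (reachSet g r.input).ncard :=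
        Nat.pow_le_pow_right (by norm_num) hB
      have h2 : 2 ^ ((reachSet g C).ncard + 1) ≤ 2 ^ (reachSet g r.input).ncard :=
        Nat.pow_le_pow_right (by norm_num) hC
      simp only [ho, symWeight, List.map_cons, List.map_nil, List.sum_cons, List.sum_nil]
      rw [pow_succ] at h1 h2
      omega
    · simp [ho, symWeight, Nat.one_le_two_pow]
  simp only [List.map_append, List.sum_append, List.map_cons, List.map_nil, List.sum_cons,
    List.sum_nil]
  omega

/-- Let `G` be a CFG in Chomsky normal form such that no variable
derives, in one or more derivation steps, a sentential form containing that same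
variable.  Then every terminal word in the language of `G` has length at most
`2 ^ |V|`, where `|V|` is the number of variables of `G`. -/
theorem stmt11 {T : Type} (g : ContextFreeGrammar T) [Finite g.NT]
    (hcnf : IsCNF g)
    (hnoself : ∀ A : g.NT, ¬ ∃ v u : List (Symbol T g.NT),
      g.Produces [Symbol.nonterminal A] v ∧ g.Derives v u ∧
      Symbol.nonterminal A ∈ u) :
    ∀ w ∈ g.language, w.length ≤ 2 ^ (Nat.card g.NT) := by
  intro w hw
  rw [ContextFreeGrammar.mem_language_iff] at hw
  have main : ∀ u v : List (Symbol T g.NT), g.Derives u v →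
      (v.map (symWeight g)).sum ≤ (u.map (symWeight g)).sum := by
    intro u v h
    induction h with
    | refl => exact le_rfl
    | tail _ h2 ih => exact (weight_produces g hcnf hnoself h2).trans ih
  have h := main _ _ hw
  have hl : ((w.map (Symbol.terminal (N := g.NT))).map (symWeight g)).sum = w.length := by
    simp [Function.comp_def, symWeight]
  rw [hl] at h
  refine h.trans ?_
  simp only [symWeight, List.map_cons, List.map_nil, List.sum_cons, List.sum_nil, add_zero]
  exact Nat.pow_le_pow_right (by norm_num) (Set.ncard_le_card _)
end

section
/- Let G be a context-free grammar in Chomsky normal form in which every variable is reachable from the start symbol (occurs in some sentential form derivable from the start symbol) and every variable derives at least one terminal word, and suppose the language of G is finite. Then the directed graph whose vertices are the variables of G, with an edge from A to B whenever B occurs in the body of some production with head A, is acyclic. -/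
theorem cnf_length_le {T : Type} (g : ContextFreeGrammar T) (hcnf : IsCNF g)
    {u v : List (Symbol T g.NT)} (h : g.Derives u v) : u.length ≤ v.length := by
  induction h with
  | refl => exact le_rfl
  | tail _ hp ih =>
    refine ih.trans ?_
    obtain ⟨r, hr, hrw⟩ := hp
    obtain ⟨p, q, rfl, rfl⟩ := hrw.exists_parts
    rcases hcnf r hr with ⟨B, C, h⟩ | ⟨a, h⟩ <;> simp [h]

theorem cnf_exists_word {T : Type} (g : ContextFreeGrammar T) (hcnf : IsCNF g)
    (hprod : ∀ A : g.NT, ∃ w : List T,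
      g.Derives [Symbol.nonterminal A] (w.map Symbol.terminal))
    (u : List (Symbol T g.NT)) :
    ∃ w : List T, g.Derives u (w.map Symbol.terminal) ∧ u.length ≤ w.length := by
  have key : ∃ w : List T, g.Derives u (w.map Symbol.terminal) := by
    induction u with
    | nil => exact ⟨[], ContextFreeGrammar.Derives.refl _⟩
    | cons x u ih =>
      obtain ⟨w, hw⟩ := ih
      have hx : ∃ w' : List T, g.Derives [x] (w'.map Symbol.terminal) := by
        cases x with
        | terminal a => exact ⟨[a], ContextFreeGrammar.Derives.refl _⟩
        | nonterminal A => exact hprod A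
      obtain ⟨w', hw'⟩ := hx
      refine ⟨w' ++ w, ?_⟩
      rw [List.map_append]
      exact (hw.append_left [x]).trans (hw'.append_right _)
  obtain ⟨w, hw⟩ := key
  exact ⟨w, hw, by simpa using cnf_length_le g hcnf hw⟩

theorem cnf_step {T : Type} (g : ContextFreeGrammar T) (hcnf : IsCNF g) {A B : g.NT}
    (h : ∃ r ∈ g.rules, r.input = A ∧ Symbol.nonterminal B ∈ r.output)
    (u : List (Symbol T g.NT)) (hA : Symbol.nonterminal A ∈ u) :
    ∃ v, g.Derives u v ∧ Symbol.nonterminal B ∈ v ∧ u.length < v.length := by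
  obtain ⟨r, hr, rfl, hB⟩ := h
  obtain ⟨p, q, rfl⟩ := List.append_of_mem hA
  refine ⟨p ++ r.output ++ q, ?_, by simp [hB], ?_⟩
  · apply ContextFreeGrammar.Produces.single
    refine ⟨r, hr, ?_⟩
    simpa using r.rewrites_of_exists_parts p q
  · rcases hcnf r hr with ⟨C, D, h⟩ | ⟨a, h⟩
    · simp [h]
    · simp [h] at hB

theorem cnf_path {T : Type} (g : ContextFreeGrammar T) (hcnf : IsCNF g) {A B : g.NT}
    (h : Relation.TransGen
      (fun X Y : g.NT => ∃ r ∈ g.rules, r.input = X ∧ Symbol.nonterminal Y ∈ r.output) A B)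
    (u : List (Symbol T g.NT)) (hA : Symbol.nonterminal A ∈ u) :
    ∃ v, g.Derives u v ∧ Symbol.nonterminal B ∈ v ∧ u.length < v.length := by
  induction h with
  | single h => exact cnf_step g hcnf h u hA
  | tail _ h ih =>
    obtain ⟨v, hv, hm, hl⟩ := ih
    obtain ⟨v', hv', hm', hl'⟩ := cnf_step g hcnf h v hm
    exact ⟨v', hv.trans hv', hm', hl.trans hl'⟩

/-- Let `G` be a CFG in Chomsky normal form in which every variable is
reachable from the start symbol and every variable derives at least one terminal
word, and suppose the language of `G` is finite.  Then the directed graph on the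
variables of `G`, with an edge from `A` to `B` whenever `B` occurs in the body of
some production with head `A`, is acyclic (no variable lies on a cycle). -/
theorem stmt12 {T : Type} (g : ContextFreeGrammar T)
    (hcnf : IsCNF g)
    (hreach : ∀ A : g.NT, ∃ u : List (Symbol T g.NT),
      g.Derives [Symbol.nonterminal g.initial] u ∧ Symbol.nonterminal A ∈ u)
    (hprod : ∀ A : g.NT, ∃ w : List T,
      g.Derives [Symbol.nonterminal A] (w.map Symbol.terminal))
    (hfin : g.language.Finite) :
    ∀ A : g.NT, ¬ Relation.TransGen
      (fun X Y : g.NT => ∃ r ∈ g.rules, r.input = X ∧ Symbol.nonterminal Y ∈ r.output)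
      A A := by
  intro A hA
  have hlong : ∀ n : ℕ, ∃ u : List (Symbol T g.NT),
      g.Derives [Symbol.nonterminal g.initial] u ∧ Symbol.nonterminal A ∈ u ∧ n ≤ u.length := by
    intro n
    induction n with
    | zero =>
      obtain ⟨u, hu, hm⟩ := hreach A
      exact ⟨u, hu, hm, Nat.zero_le _⟩
    | succ n ih =>
      obtain ⟨u, hu, hm, hl⟩ := ih
      obtain ⟨v, hv, hm', hl'⟩ := cnf_path g hcnf hA u hm
      exact ⟨v, hu.trans hv, hm', by omega⟩
  obtain ⟨N, hN⟩ := (Set.Finite.image List.length hfin).bddAbove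
  obtain ⟨u, hu, -, hl⟩ := hlong (N + 1)
  obtain ⟨w, hw, hlw⟩ := cnf_exists_word g hcnf hprod u
  have hmem : w ∈ g.language := (g.mem_language_iff w).2 (hu.trans hw)
  have := hN (Set.mem_image_of_mem List.length hmem)
  omega
end

section
/- Let G be a context-free grammar in Chomsky normal form with finite language, in which every variable is reachable from the start symbol and every variable derives at least one terminal word. Define W₀(X) = 0 for every variable X, and W_{n+1}(X) = max of: W_n(X); W_n(B) + W_n(C) over all productions X → BC; and 1 if there is a production X → a. Then for every n ≥ |V| and every variable X, W_n(X) equals the maximum length of a terminal word derivable from X; in particular the iteration reaches its fixed point after at most |V| iterations. -/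
/-- `W` satisfies the iteration scheme: `W 0 X = 0`, and `W (n+1) X` is the maximum
of `W n X`, of `W n B + W n C` over all productions `X → BC`, and of `1` if there is
a production `X → a`. -/
def IterSpec {T : Type} (g : ContextFreeGrammar T) (W : ℕ → g.NT → ℕ) : Prop :=
  (∀ X, W 0 X = 0) ∧
  ∀ n X, IsGreatest
    ({W n X} ∪
     {v | ∃ r ∈ g.rules, r.input = X ∧ ∃ B C : g.NT,
        r.output = [Symbol.nonterminal B, Symbol.nonterminal C] ∧ v = W n B + W n C} ∪
     {v | ∃ r ∈ g.rules, r.input = X ∧ (∃ a : T, r.output = [Symbol.terminal a]) ∧ v = 1})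
    (W (n+1) X)

namespace CNFAux

variable {T : Type} {g : ContextFreeGrammar T}

/-- `Child g Y X`: the variable `Y` occurs in a binary production of `X`. -/
def Child (g : ContextFreeGrammar T) (Y X : g.NT) : Prop :=
  ∃ r ∈ g.rules, r.input = X ∧ ∃ B C : g.NT,
    r.output = [Symbol.nonterminal B, Symbol.nonterminal C] ∧ (Y = B ∨ Y = C)

lemma derives_rule {r : ContextFreeRule T g.NT} (hr : r ∈ g.rules) :
    g.Derives [Symbol.nonterminal r.input] r.output :=
  ContextFreeGrammar.Produces.single ⟨r, hr, ContextFreeRule.Rewrites.input_output⟩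

lemma derives_append {a b c d : List (Symbol T g.NT)} (h1 : g.Derives a b) (h2 : g.Derives c d) :
    g.Derives (a ++ c) (b ++ d) :=
  (h1.append_right c).trans (h2.append_left b)

lemma len_mono (hcnf : IsCNF g) {s t : List (Symbol T g.NT)} (h : g.Derives s t) :
    s.length ≤ t.length := by
  induction h with
  | refl => exact le_rfl
  | tail _ h2 ih =>
    obtain ⟨r, hr, hrw⟩ := h2
    obtain ⟨p, q, rfl, rfl⟩ := hrw.exists_parts
    rcases hcnf r hr with ⟨B, C, h⟩ | ⟨a, h⟩ <;> rw [h] <;> simp at * <;> omega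

lemma term (hprod : ∀ A : g.NT, ∃ w : List T,
      g.Derives [Symbol.nonterminal A] (w.map Symbol.terminal)) (s : List (Symbol T g.NT)) :
    ∃ w : List T, g.Derives s (w.map Symbol.terminal) := by
  induction s with
  | nil => exact ⟨[], ContextFreeGrammar.Derives.refl _⟩
  | cons a s ih =>
    obtain ⟨w, hw⟩ := ih
    cases a with
    | terminal a =>
      exact ⟨a :: w, by simpa using hw.append_left [Symbol.terminal a]⟩
    | nonterminal A =>
      obtain ⟨v, hv⟩ := hprod A
      exact ⟨v ++ w, by simpa using derives_append hv hw⟩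

lemma split {s t : List (Symbol T g.NT)} (h : g.Derives s t) :
    ∀ u v, s = u ++ v → ∃ u' v', t = u' ++ v' ∧ g.Derives u u' ∧ g.Derives v v' := by
  induction h with
  | refl =>
    intro u v h
    exact ⟨u, v, h, ContextFreeGrammar.Derives.refl _, ContextFreeGrammar.Derives.refl _⟩
  | tail _ h2 ih =>
    intro u v h
    obtain ⟨u', v', e, hu, hv⟩ := ih u v h
    obtain ⟨r, hr, hrw⟩ := h2
    obtain ⟨p, q, e1, rfl⟩ := hrw.exists_parts
    rw [e1, List.append_assoc, List.append_eq_append_iff] at e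
    rcases e with ⟨x, hx1, hx2⟩ | ⟨x, hx1, hx2⟩
    · cases x with
      | nil =>
        simp only [List.nil_append, List.append_nil] at hx1 hx2
        subst hx1
        refine ⟨u', r.output ++ q, by simp, hu, hv.trans ?_⟩
        rw [← hx2]
        exact (derives_rule hr).append_right q
      | cons y x =>
        simp only [List.cons_append, List.nil_append, List.cons.injEq] at hx2
        obtain ⟨rfl, rfl⟩ := hx2
        refine ⟨p ++ r.output ++ x, v', by simp, hu.trans ?_, hv⟩
        rw [hx1]
        simpa using ((derives_rule hr).append_right x).append_left p
    · subst hx1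
      refine ⟨u', x ++ r.output ++ q, by simp, hu, hv.trans ?_⟩
      rw [hx2]
      simpa using ((derives_rule hr).append_right q).append_left x

lemma child_context {Y X : g.NT} (h : Relation.TransGen (Child g) Y X) :
    ∃ u v : List (Symbol T g.NT), 1 ≤ u.length + v.length ∧
      g.Derives [Symbol.nonterminal X] (u ++ [Symbol.nonterminal Y] ++ v) := by
  have base : ∀ {Y X : g.NT}, Child g Y X → ∃ u v : List (Symbol T g.NT),
      1 ≤ u.length + v.length ∧
      g.Derives [Symbol.nonterminal X] (u ++ [Symbol.nonterminal Y] ++ v) := by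
    rintro Y X ⟨r, hr, rfl, B, C, ho, rfl | rfl⟩
    · exact ⟨[], [Symbol.nonterminal C], by simp, by simpa [ho] using derives_rule hr⟩
    · exact ⟨[Symbol.nonterminal B], [], by simp, by simpa [ho] using derives_rule hr⟩
  induction h with
  | single h => exact base h
  | tail _ h ih =>
    obtain ⟨u, v, hl, hd⟩ := ih
    obtain ⟨u', v', hl', hd'⟩ := base h
    refine ⟨u' ++ u, v ++ v', by simp; omega, hd'.trans ?_⟩
    simpa using (hd.append_right v').append_left u'

lemma pump {X : g.NT} (h : Relation.TransGen (Child g) X X) (n : ℕ) :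
    ∃ u v : List (Symbol T g.NT), n ≤ u.length + v.length ∧
      g.Derives [Symbol.nonterminal X] (u ++ [Symbol.nonterminal X] ++ v) := by
  induction n with
  | zero => exact ⟨[], [], by simp, ContextFreeGrammar.Derives.refl _⟩
  | succ n ih =>
    obtain ⟨u, v, hl, hd⟩ := ih
    obtain ⟨u', v', hl', hd'⟩ := child_context h
    refine ⟨u' ++ u, v ++ v', by simp; omega, hd'.trans ?_⟩
    simpa using (hd.append_right v').append_left u'

lemma acyclic (hcnf : IsCNF g) (hfin : g.language.Finite)
    (hreach : ∀ A : g.NT, ∃ u : List (Symbol T g.NT),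
      g.Derives [Symbol.nonterminal g.initial] u ∧ Symbol.nonterminal A ∈ u)
    (hprod : ∀ A : g.NT, ∃ w : List T,
      g.Derives [Symbol.nonterminal A] (w.map Symbol.terminal)) (X : g.NT) :
    ¬ Relation.TransGen (Child g) X X := by
  intro h
  obtain ⟨N, hN⟩ := (hfin.image List.length).bddAbove
  obtain ⟨s, hs, hX⟩ := hreach X
  obtain ⟨p, q, rfl⟩ := List.append_of_mem hX
  obtain ⟨u, v, hl, hd⟩ := pump h (N + 1)
  have h1 : g.Derives [Symbol.nonterminal g.initial]
      (p ++ (u ++ [Symbol.nonterminal X] ++ v) ++ q) := by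
    refine hs.trans ?_
    simpa using (hd.append_right q).append_left p
  obtain ⟨w, hw⟩ := term hprod (p ++ (u ++ [Symbol.nonterminal X] ++ v) ++ q)
  have h2 := len_mono hcnf hw
  have h3 : w.length ≤ N := hN ⟨w, h1.trans hw, rfl⟩
  simp at h2
  omega

lemma no_terminal {w : List T} {t : List (Symbol T g.NT)}
    (h : g.Derives (w.map Symbol.terminal) t) : t = w.map Symbol.terminal := by
  rcases h.eq_or_head with h | ⟨v, hv, _⟩
  · exact h.symm
  · obtain ⟨r, _, hm⟩ := hv.exists_nonterminal_input_mem
    simp at hm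

lemma attained {W : ℕ → g.NT → ℕ} (hprod : ∀ A : g.NT, ∃ w : List T,
      g.Derives [Symbol.nonterminal A] (w.map Symbol.terminal)) (hW : IterSpec g W) (n : ℕ) :
    ∀ X, ∃ w : List T, g.Derives [Symbol.nonterminal X] (w.map Symbol.terminal) ∧
      W n X ≤ w.length := by
  induction n with
  | zero =>
    intro X
    obtain ⟨w, hw⟩ := hprod X
    exact ⟨w, hw, by simp [hW.1]⟩
  | succ n ih =>
    intro X
    rcases (hW.2 n X).1 with (h | ⟨r, hr, rfl, B, C, ho, hv⟩) | ⟨r, hr, rfl, ⟨a, ho⟩, hv⟩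
    · rw [Set.mem_singleton_iff.1 h]
      exact ih X
    · obtain ⟨b, hb, lb⟩ := ih B
      obtain ⟨c, hc, lc⟩ := ih C
      refine ⟨b ++ c, ?_, by rw [hv]; simp; omega⟩
      have := derives_rule hr
      rw [ho] at this
      refine this.trans ?_
      simpa using derives_append hb hc
    · refine ⟨[a], ?_, by simp [hv]⟩
      simpa [ho] using derives_rule hr

lemma bound {W : ℕ → g.NT → ℕ} (hcnf : IsCNF g) (hW : IterSpec g W) (h : g.NT → ℕ)
    (hpos : ∀ X, 0 < h X) (hlt : ∀ Y X, Child g Y X → h Y < h X) (n : ℕ) :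
    ∀ X, h X ≤ n → ∀ w : List T, g.Derives [Symbol.nonterminal X] (w.map Symbol.terminal) →
      w.length ≤ W n X := by
  induction n with
  | zero =>
    intro X hX
    have := hpos X
    omega
  | succ n ih =>
    intro X hX w hw
    rcases hw.eq_or_head with h0 | ⟨v, ⟨r, hr, hrw⟩, hv⟩
    · cases w <;> simp at h0
    have hrX : r.input = X ∧ v = r.output := by
      obtain ⟨p, q, e, rfl⟩ := hrw.exists_parts
      have hl := congrArg List.length e
      simp at hl
      have hp : p = [] := List.length_eq_zero_iff.1 (by omega)
      have hq : q = [] := List.length_eq_zero_iff.1 (by omega)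
      subst hp hq
      simp at e
      exact ⟨e.symm, by simp⟩
    obtain ⟨hi, rfl⟩ := hrX
    rcases hcnf r hr with ⟨B, C, ho⟩ | ⟨a, ho⟩
    · have hB := hlt B X ⟨r, hr, hi, B, C, ho, Or.inl rfl⟩
      have hC := hlt C X ⟨r, hr, hi, B, C, ho, Or.inr rfl⟩
      obtain ⟨b, c, e, hb, hc⟩ := split hv [Symbol.nonterminal B] [Symbol.nonterminal C]
        (by simp [ho])
      obtain ⟨b, c, rfl, rfl, rfl⟩ := List.map_eq_append_iff.1 e
      have h1 := ih B (by omega) b hb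
      have h2 := ih C (by omega) c hc
      have h3 := (hW.2 n X).2 (Or.inl (Or.inr ⟨r, hr, hi, B, C, ho, rfl⟩))
      simp
      omega
    · rw [ho] at hv
      have e := congrArg List.length (no_terminal (w := [a]) hv)
      have h3 := (hW.2 n X).2 (Or.inr ⟨r, hr, hi, ⟨a, ho⟩, rfl⟩)
      simp at e
      omega

end CNFAux

/-- Let `G` be a CFG in Chomsky normal form with finite language, in
which every variable is reachable from the start symbol and every variable derives at
least one terminal word.  Then for every `n ≥ |V|` and every variable `X`, `W n X`
equals the maximum length of a terminal word derivable from `X`; in particular the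
iteration reaches its fixed point after at most `|V|` iterations. -/
theorem stmt13 {T : Type} (g : ContextFreeGrammar T) [Finite g.NT]
    (hcnf : IsCNF g) (hfin : g.language.Finite)
    (hreach : ∀ A : g.NT, ∃ u : List (Symbol T g.NT),
      g.Derives [Symbol.nonterminal g.initial] u ∧ Symbol.nonterminal A ∈ u)
    (hprod : ∀ A : g.NT, ∃ w : List T,
      g.Derives [Symbol.nonterminal A] (w.map Symbol.terminal))
    (W : ℕ → g.NT → ℕ) (hW : IterSpec g W) :
    (∀ n, Nat.card g.NT ≤ n → ∀ X : g.NT,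
      IsGreatest {l : ℕ | ∃ w : List T,
        g.Derives [Symbol.nonterminal X] (w.map Symbol.terminal) ∧ l = w.length}
        (W n X)) ∧
    (∀ n, Nat.card g.NT ≤ n → ∀ X : g.NT, W n X = W (Nat.card g.NT) X) := by
  classical
  have hac := CNFAux.acyclic hcnf hfin hreach hprod
  let D : g.NT → Set g.NT := fun X => {Y | Relation.ReflTransGen (CNFAux.Child g) Y X}
  have hpos : ∀ X, 0 < (D X).ncard := fun X =>
    (Set.ncard_pos (Set.toFinite _)).2 ⟨X, Relation.ReflTransGen.refl⟩
  have hlt : ∀ Y X, CNFAux.Child g Y X → (D Y).ncard < (D X).ncard := by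
    intro Y X h
    apply Set.ncard_lt_ncard _ (Set.toFinite _)
    refine ⟨fun Z hZ => Relation.ReflTransGen.tail hZ h, fun hsub => ?_⟩
    have hX : X ∈ D Y := hsub (Relation.ReflTransGen.refl : X ∈ D X)
    exact hac X (Relation.TransGen.tail' hX h)
  have hle : ∀ X, (D X).ncard ≤ Nat.card g.NT := fun X => by
    rw [← Set.ncard_univ]
    exact Set.ncard_le_ncard (Set.subset_univ _) (Set.toFinite _)
  have main : ∀ n, Nat.card g.NT ≤ n → ∀ X : g.NT,
      IsGreatest {l : ℕ | ∃ w : List T,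
        g.Derives [Symbol.nonterminal X] (w.map Symbol.terminal) ∧ l = w.length}
        (W n X) := by
    intro n hn X
    have hb := CNFAux.bound hcnf hW (fun X => (D X).ncard) hpos hlt n X ((hle X).trans hn)
    refine ⟨?_, ?_⟩
    · obtain ⟨w, hw, hl⟩ := CNFAux.attained hprod hW n X
      exact ⟨w, hw, le_antisymm hl (hb w hw)⟩
    · rintro l ⟨w, hw, rfl⟩
      exact hb w hw
  exact ⟨main, fun n hn X => (main n hn X).unique (main _ le_rfl X)⟩
end

section
/- For every C1PVASS A with arbitrary integer counter updates there exists a C1PVASS A' whose counter updates all lie in {−1,0,+1}, with additional stack symbols and states, such that for every k ∈ ℝ≥0, A has a k-reaching run if and only if A' has a k-reaching run, and A has a k-covering run if and only if A' has a k-covering run; moreover the number of states and transitions of A' is at most quadratic in the size of the binary encoding of A (i.e., polynomial in |S| + |δ| + ⌈log₂ W⌉, where W is the largest absolute value of a counter update of A). -/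
/-- The number of transitions of a C1PVASS (pairs of states on which `δ` is defined). -/
noncomputable def transCount {S Γ : Type} (A : C1PVASS S Γ) : ℕ :=
  Nat.card {p : S × S // (A.δ p.1 p.2).isSome}


namespace Gadget

open C1PVASS Relation

variable {S Γ : Type}

/-- One step, with the scaling factor hidden. -/
def R (A : C1PVASS S Γ) (q q' : Config S Γ) : Prop := ∃ γ, A.Step q q' γ

/-- Reachability from the initial configuration. -/
def Reach (A : C1PVASS S Γ) (q : Config S Γ) : Prop := ReflTransGen (R A) A.init q

theorem run_of_reach (A : C1PVASS S Γ) {q : Config S Γ} (h : Reach A q) :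
    ∃ n π, A.IsRun n π ∧ π n = q := by
  induction h with
  | refl => exact ⟨0, fun _ => A.init, ⟨fun _ => 1, rfl, by intro i hi; omega⟩, rfl⟩
  | @tail b c _ hs ih =>
    obtain ⟨n, π, ⟨γ, h0, hr⟩, hn⟩ := ih
    obtain ⟨g, hg⟩ := hs
    refine ⟨n + 1, fun i => if i ≤ n then π i else c,
      ⟨fun i => if i < n then γ i else g, by simpa using h0, ?_⟩, by simp⟩
    intro i hi
    by_cases h : i < n
    · have h1 : i ≤ n := h.le
      have h2 : i + 1 ≤ n := h
      simpa only [h1, h2, h, if_true] using hr i h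
    · have : i = n := by omega
      subst this
      simpa [hn] using hg

theorem reach_of_run (A : C1PVASS S Γ) {n : ℕ} {π : ℕ → Config S Γ} (h : A.IsRun n π) :
    Reach A (π n) := by
  obtain ⟨γ, h0, hr⟩ := h
  have : ∀ i ≤ n, Reach A (π i) := by
    intro i
    induction i with
    | zero => intro _; rw [h0]; exact ReflTransGen.refl
    | succ i ih => intro hi; exact (ih (by omega)).tail ⟨γ i, hr i (by omega)⟩
  exact this n le_rfl

theorem mem_acc (A : C1PVASS S Γ) (c : ℝ) :
    c ∈ A.AccValues ↔ ∃ α, Reach A ⟨A.f, α, c⟩ := by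
  constructor
  · rintro ⟨n, π, h, hf, hc⟩
    refine ⟨(π n).stack, ?_⟩
    have := reach_of_run A h
    rw [← hf, ← hc]; exact this
  · rintro ⟨α, h⟩
    obtain ⟨n, π, hr, hn⟩ := run_of_reach A h
    exact ⟨n, π, hr, by rw [hn], by rw [hn]⟩

theorem reach_nonneg (A : C1PVASS S Γ) {q : Config S Γ} (h : Reach A q) : 0 ≤ q.counter := by
  cases h with
  | refl => exact le_rfl
  | tail _ hs =>
    obtain ⟨γ, u, op, _, _, _, _, hl, _⟩ := hs
    exact le_trans (Nat.cast_nonneg _) hl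

/-- The transitions of `A`. -/
abbrev T (A : C1PVASS S Γ) : Type := {p : S × S // (A.δ p.1 p.2).isSome}

/-- States of the new automaton. -/
inductive St (S T : Type) (N : ℕ) where
  | st : S → St S T N
  | m : T → St S T N
  | e : T → St S T N
  | a : T → Fin N → St S T N
  | b : T → Fin N → St S T N
  | L : St S T N

/-- Stack symbols of the new automaton. -/
inductive Sy (Γ T : Type) where
  | old : Γ → Sy Γ T
  | X : T → ℕ → Sy Γ T
  | ret : T → Sy Γ T

/-- the counter update of a transition -/
def U (A : C1PVASS S Γ) (t : T A) : ℤ := ((A.δ t.1.1 t.1.2).get t.2).1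

/-- the stack operation of a transition -/
def Op (A : C1PVASS S Γ) (t : T A) : Option (StackOp Γ) := ((A.δ t.1.1 t.1.2).get t.2).2

theorem delta_eq (A : C1PVASS S Γ) (t : T A) : A.δ t.1.1 t.1.2 = some (U A t, Op A t) := by
  simp [U, Op]

/-- number of unit steps a symbol `X t i` stands for -/
def val (A : C1PVASS S Γ) (t : T A) (i : ℕ) : ℕ := (U A t).natAbs / 2 ^ i

theorem val_zero (A : C1PVASS S Γ) (t : T A) : val A t 0 = (U A t).natAbs := by simp [val]

theorem val_succ (A : C1PVASS S Γ) (t : T A) (i : ℕ) :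
    val A t i = val A t i % 2 + 2 * val A t (i + 1) := by
  have : val A t (i + 1) = val A t i / 2 := by
    simp [val, pow_succ, Nat.div_div_eq_div_mul]
  rw [this]; omega

/-- lift of stack operations -/
def liftOp {T : Type} : Option (StackOp Γ) → Option (StackOp (Sy Γ T))
  | none => none
  | some (.push a) => some (.push (.old a))
  | some (.pop a) => some (.pop (.old a))

open Classical in
/-- transition function of the new automaton -/
noncomputable def D (A : C1PVASS S Γ) (N : ℕ) :
    St S (T A) N → St S (T A) N → Option (ℤ × Option (StackOp (Sy Γ (T A))))
  | .st s, .m t => if t.1.1 = s then some (0, some (.push (.ret t))) else none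
  | .m t, .L => some (0, some (.push (.X t 0)))
  | .L, .a t i => some (0, some (.pop (.X t i)))
  | .a t i, .L => if val A t i = 0 then some (0, none) else none
  | .a t i, .b t' j => if (t' = t ∧ j = i) ∧ val A t i ≠ 0 then
      some ((U A t).sign * ((val A t i % 2 : ℕ) : ℤ), some (.push (.X t (i + 1)))) else none
  | .b t i, .L => some (0, some (.push (.X t (i + 1))))
  | .L, .e t => some (0, some (.pop (.ret t)))
  | .e t, .st s => if t.1.2 = s then some (0, liftOp (Op A t)) else none
  | _, _ => none

/-- the new automaton -/
noncomputable def B (A : C1PVASS S Γ) (N : ℕ) : C1PVASS (St S (T A) N) (Sy Γ (T A)) where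
  δ := D A N
  bot := .old A.bot
  s0 := .st A.s0
  f := .st A.f
  lb := fun q => match q with
    | .st s => A.lb s
    | _ => 0

theorem updates (A : C1PVASS S Γ) (N : ℕ) : (B A N).UpdatesIn := by
  intro s s' u op h
  change D A N s s' = some (u, op) at h
  unfold D at h
  split at h
  case h_5 t i t' j =>
    split_ifs at h
    simp only [Option.some.injEq, Prod.mk.injEq] at h
    rw [← h.1]
    rcases Nat.mod_two_eq_zero_or_one (val A t i) with h | h <;> rw [h]
    · simp
    · rcases Int.sign_trichotomy (U A t) with h | h | h <;> simp [h]
  all_goals (try split_ifs at h) <;> simp_all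

/-- bound kept while simulating a transition -/
def Bnd (A : C1PVASS S Γ) (t : T A) (α : List Γ) (c : ℝ) (Φ : ℕ) : Prop :=
  ∃ c0 x : ℝ, Reach A ⟨t.1.1, α, c0⟩ ∧ c = c0 + ((U A t).sign : ℝ) * x ∧ 0 ≤ x ∧
    x + Φ ≤ (U A t).natAbs ∧ (Φ < (U A t).natAbs → 0 < x)

/-- soundness invariant -/
def Inv (A : C1PVASS S Γ) (N : ℕ) (q : Config (St S (T A) N) (Sy Γ (T A))) : Prop :=
  match q.state with
  | .st s => ∃ α : List Γ, q.stack = α.map .old ∧ Reach A ⟨s, α, q.counter⟩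
  | .m t => ∃ α : List Γ, q.stack = .ret t :: α.map .old ∧
      Bnd A t α q.counter (U A t).natAbs
  | .L => ∃ (t : T A) (α : List Γ) (l : List ℕ),
      q.stack = l.map (.X t) ++ .ret t :: α.map .old ∧
      Bnd A t α q.counter (l.map (val A t)).sum
  | .a t i => ∃ (α : List Γ) (l : List ℕ),
      q.stack = l.map (.X t) ++ .ret t :: α.map .old ∧
      Bnd A t α q.counter (val A t i + (l.map (val A t)).sum)
  | .b t i => ∃ (α : List Γ) (l : List ℕ),
      q.stack = l.map (.X t) ++ .ret t :: α.map .old ∧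
      Bnd A t α q.counter (val A t (i + 1) + (l.map (val A t)).sum)
  | .e t => ∃ α : List Γ, q.stack = α.map .old ∧ Bnd A t α q.counter 0

theorem stack_lift (A : C1PVASS S Γ) (N : ℕ) (op : Option (StackOp Γ)) (α : List Γ)
    (β' : List (Sy Γ (T A))) (h : (B A N).StackOk (liftOp op) (α.map .old) β') :
    ∃ β : List Γ, β' = β.map .old ∧ A.StackOk op α β := by
  rcases op with _ | ⟨a | a⟩
  · exact ⟨α, h, rfl⟩
  · obtain ⟨h1, h2⟩ := h
    exact ⟨a :: α, h2, fun h => h1 (by rw [h]; rfl), rfl⟩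
  · obtain ⟨h1, h2⟩ := h
    cases α with
    | nil => simp at h2
    | cons x α =>
      simp only [List.map_cons, List.cons.injEq, Sy.old.injEq] at h2
      exact ⟨α, h2.2.symm, fun h => h1 (by rw [h]; rfl), by rw [h2.1]⟩

theorem stack_lift' (A : C1PVASS S Γ) (N : ℕ) (op : Option (StackOp Γ)) (α β : List Γ)
    (h : A.StackOk op α β) : (B A N).StackOk (liftOp op) (α.map .old) (β.map .old) := by
  rcases op with _ | ⟨a | a⟩
  · have : β = α := h
    rw [this]; rfl
  · obtain ⟨h1, h2⟩ := h
    refine ⟨fun h => h1 ?_, by rw [h2]; rfl⟩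
    simpa [B] using h
  · obtain ⟨h1, h2⟩ := h
    refine ⟨fun h => h1 ?_, by rw [h2]; rfl⟩
    simpa [B] using h

theorem sign_mul_natAbs_real (u : ℤ) : (u.sign : ℝ) * (u.natAbs : ℝ) = (u : ℝ) := by
  have h := congrArg (Int.cast : ℤ → ℝ) (Int.sign_mul_natAbs u)
  rw [Int.cast_mul, Int.cast_natCast] at h
  exact h

theorem inv_step (A : C1PVASS S Γ) (N : ℕ) (q q' : Config (St S (T A) N) (Sy Γ (T A)))
    (hq : Inv A N q) (h : R (B A N) q q') : Inv A N q' := by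
  obtain ⟨γ, u, op, hd, hγ0, hγ1, hc, hl, hs⟩ := h
  obtain ⟨s, σ, c⟩ := q
  obtain ⟨s', σ', c'⟩ := q'
  change D A N s s' = some (u, op) at hd
  simp only at hc hl hs
  unfold D at hd
  split at hd
  case h_1 s t =>
    split_ifs at hd with hh
    cases hd
    subst hh
    obtain ⟨α, h1, h2⟩ := hq
    simp only at h1 h2
    refine ⟨α, ?_, c, 0, h2, ?_, le_rfl, ?_, ?_⟩
    · rw [hs.2, h1]
    · simp [hc]
    · simp
    · intro h; exact absurd h (lt_irrefl _)
  case h_2 t =>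
    cases hd
    obtain ⟨α, h1, h2⟩ := hq
    simp only [Int.cast_zero, mul_zero, add_zero] at h1 h2 hc
    refine ⟨t, α, [0], ?_, ?_⟩
    · simp only; rw [hs.2, h1]; rfl
    · simpa [val_zero, hc] using h2
  case h_3 t i =>
    cases hd
    obtain ⟨t', α, l, h1, h2⟩ := hq
    simp only [Int.cast_zero, mul_zero, add_zero] at h1 h2 hc
    have h3 := hs.2
    rw [h1] at h3
    cases l with
    | nil => simp at h3
    | cons j l =>
      simp only [List.map_cons, List.cons_append, List.cons.injEq, Sy.X.injEq] at h3
      obtain ⟨⟨rfl, rfl⟩, h3⟩ := h3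
      refine ⟨α, l, h3.symm, ?_⟩
      simpa [hc] using h2
  case h_4 t i =>
    split_ifs at hd with hh
    cases hd
    obtain ⟨α, l, h1, h2⟩ := hq
    simp only [Int.cast_zero, mul_zero, add_zero] at h1 h2 hc
    have h3 : σ' = σ := hs
    refine ⟨t, α, l, by simp only; rw [h3, h1], ?_⟩
    simpa [hc, hh] using h2
  case h_5 t i t' j =>
    split_ifs at hd with hh
    cases hd
    obtain ⟨⟨rfl, rfl⟩, hv⟩ := hh
    obtain ⟨α, l, h1, c0, x, hr, hcx, hx0, hx1, hx2⟩ := hq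
    simp only at h1 hcx hx1 hx2
    refine ⟨α, (j + 1 : ℕ) :: l, ?_, c0, x + γ * (val A t' j % 2 : ℕ), hr, ?_, ?_, ?_, ?_⟩
    · simp only; rw [hs.2, h1]; rfl
    · simp only; rw [hc, hcx, Int.cast_mul, Int.cast_natCast]; ring
    · positivity
    · have e := val_succ A t' j
      have : (val A t' j : ℝ) = ((val A t' j % 2 : ℕ) : ℝ) + 2 * (val A t' (j + 1) : ℕ) := by
        exact_mod_cast e
      have h5 : (0:ℝ) ≤ ((val A t' j % 2 : ℕ) : ℝ) := Nat.cast_nonneg _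
      have h6 := mul_le_mul_of_nonneg_right hγ1 h5
      simp only [List.map_cons, List.sum_cons]
      push_cast at hx1 this h6 ⊢
      linarith
    · intro h
      simp only [List.map_cons, List.sum_cons] at h
      have e := val_succ A t' j
      rcases Nat.mod_two_eq_zero_or_one (val A t' j) with h0 | h0
      · rw [h0]
        have := hx2 (by omega)
        simpa using this
      · rw [h0]
        push_cast
        linarith
  case h_6 t i =>
    cases hd
    obtain ⟨α, l, h1, h2⟩ := hq
    simp only [Int.cast_zero, mul_zero, add_zero] at h1 h2 hc
    refine ⟨t, α, (i + 1 : ℕ) :: l, ?_, ?_⟩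
    · simp only; rw [hs.2, h1]; rfl
    · simpa [hc] using h2
  case h_7 t =>
    cases hd
    obtain ⟨t', α, l, h1, h2⟩ := hq
    simp only [Int.cast_zero, mul_zero, add_zero] at h1 h2 hc
    have h3 := hs.2
    rw [h1] at h3
    cases l with
    | cons j l => simp at h3
    | nil =>
      simp only [List.map_nil, List.nil_append, List.cons.injEq, Sy.ret.injEq] at h3
      obtain ⟨rfl, h3⟩ := h3
      refine ⟨α, h3.symm, ?_⟩
      simpa [hc] using h2
  case h_8 t s =>
    split_ifs at hd with hh
    cases hd
    subst hh
    obtain ⟨α, h1, c0, x, hr, hcx, hx0, hx1, hx2⟩ := hq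
    simp only [Int.cast_zero, mul_zero, add_zero, Nat.cast_zero] at h1 hc hcx hx1
    rw [h1] at hs
    obtain ⟨β, hβ, hok⟩ := stack_lift A N _ _ _ hs
    refine ⟨β, hβ, hr.tail ?_⟩
    have key : ∃ g : ℝ, 0 < g ∧ g ≤ 1 ∧ ((U A t).sign : ℝ) * x = g * (U A t : ℝ) := by
      rcases Nat.eq_zero_or_pos (U A t).natAbs with h0 | h0
      · refine ⟨1, one_pos, le_rfl, ?_⟩
        have : U A t = 0 := Int.natAbs_eq_zero.mp h0
        simp [this]
      · have hx := hx2 h0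
        have hp : (0:ℝ) < (U A t).natAbs := by exact_mod_cast h0
        refine ⟨x / (U A t).natAbs, by positivity, (div_le_one hp).mpr hx1, ?_⟩
        rw [← sign_mul_natAbs_real (U A t)]
        field_simp
    obtain ⟨g, hg0, hg1, hg⟩ := key
    exact ⟨g, U A t, Op A t, delta_eq A t, hg0, hg1, by simp only; rw [hc, hcx, hg], hl, hok⟩
  all_goals cases hd

theorem sound (A : C1PVASS S Γ) (N : ℕ) (q : Config (St S (T A) N) (Sy Γ (T A)))
    (h : Reach (B A N) q) : Inv A N q := by
  induction h with
  | refl => exact ⟨[A.bot], rfl, ReflTransGen.refl⟩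
  | tail _ hs ih => exact inv_step A N _ _ ih hs

theorem between (s : ℤ) (g c : ℝ) (v w : ℕ) (hg : 0 < g) (hc : 0 ≤ c)
    (h : 0 ≤ c + g * (s.sign : ℝ) * v) (hw : w ≤ v) : 0 ≤ c + g * (s.sign : ℝ) * w := by
  have h1 : (w : ℝ) ≤ v := by exact_mod_cast hw
  have h0 : (0 : ℝ) ≤ w := Nat.cast_nonneg _
  rcases Int.sign_trichotomy s with e | e | e <;> rw [e] at h ⊢ <;> push_cast at h ⊢ <;> nlinarith

/-- a step with zero update -/
theorem zstep (A : C1PVASS S Γ) (N : ℕ) (s s' : St S (T A) N) (op) (σ σ' : List (Sy Γ (T A)))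
    (c : ℝ) (hd : D A N s s' = some (0, op)) (hl : ((B A N).lb s' : ℝ) ≤ c)
    (hs : (B A N).StackOk op σ σ') : R (B A N) ⟨s, σ, c⟩ ⟨s', σ', c⟩ :=
  ⟨1, 0, op, hd, one_pos, le_rfl, by simp, hl, hs⟩

theorem loop (A : C1PVASS S Γ) (N : ℕ) (t : T A) (g : ℝ) (hg0 : 0 < g) (hg1 : g ≤ 1)
    (hN : val A t N = 0) (k : ℕ) :
    ∀ i : ℕ, i + k = N → ∀ (σ : List (Sy Γ (T A))) (c : ℝ), 0 ≤ c →
      0 ≤ c + g * ((U A t).sign : ℝ) * val A t i →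
      ReflTransGen (R (B A (N + 1))) ⟨.L, .X t i :: σ, c⟩
        ⟨.L, σ, c + g * ((U A t).sign : ℝ) * val A t i⟩ := by
  induction k with
  | zero =>
    intro i hi σ c hc _
    have hi : i = N := by omega
    subst hi
    have h1 : R (B A (i + 1)) ⟨.L, .X t i :: σ, c⟩ ⟨.a t (Fin.last i), σ, c⟩ :=
      zstep A _ _ _ (some (.pop (.X t i))) _ _ _ rfl (by simpa [B] using hc)
        ⟨by simp [B], rfl⟩
    have h2 : R (B A (i + 1)) ⟨.a t (Fin.last i), σ, c⟩ ⟨.L, σ, c⟩ :=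
      zstep A _ _ _ none _ _ _ (by simp [D, hN]) (by simpa [B] using hc) rfl
    rw [hN]
    simpa using (ReflTransGen.single h1).tail h2
  | succ k ih =>
    intro i hi σ c hc hf
    have hlt : i < N + 1 := by omega
    have h1 : R (B A (N + 1)) ⟨.L, .X t i :: σ, c⟩ ⟨.a t ⟨i, hlt⟩, σ, c⟩ :=
      zstep A _ _ _ (some (.pop (.X t i))) _ _ _ rfl (by simpa [B] using hc)
        ⟨by simp [B], rfl⟩
    by_cases hv : val A t i = 0
    · have h2 : R (B A (N + 1)) ⟨.a t ⟨i, hlt⟩, σ, c⟩ ⟨.L, σ, c⟩ :=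
        zstep A _ _ _ none _ _ _ (by simp [D, hv]) (by simpa [B] using hc) rfl
      rw [hv]
      simpa using (ReflTransGen.single h1).tail h2
    · have e := val_succ A t i
      have e' : (val A t i : ℝ) = ((val A t i % 2 : ℕ) : ℝ) + 2 * (val A t (i + 1) : ℕ) := by
        exact_mod_cast e
      have p1 := between _ g c _ (val A t i % 2) hg0 hc hf (by omega)
      have p2 := between _ g c _ (val A t i % 2 + val A t (i + 1)) hg0 hc hf (by omega)
      set c1 := c + g * ((U A t).sign : ℝ) * (val A t i % 2 : ℕ) with hc1
      set c2 := c1 + g * ((U A t).sign : ℝ) * (val A t (i + 1) : ℕ) with hc2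
      have q2 : 0 ≤ c2 := by
        rw [hc2, hc1]; push_cast at p2 ⊢; linarith
      have q3 : c + g * ((U A t).sign : ℝ) * val A t i
          = c2 + g * ((U A t).sign : ℝ) * (val A t (i + 1) : ℕ) := by
        rw [hc2, hc1, e']; ring
      have h2 : R (B A (N + 1)) ⟨.a t ⟨i, hlt⟩, σ, c⟩
          ⟨.b t ⟨i, hlt⟩, .X t (i + 1) :: σ, c1⟩ := by
        refine ⟨g, (U A t).sign * ((val A t i % 2 : ℕ) : ℤ), some (.push (.X t (i + 1))),
          ?_, hg0, hg1, ?_, ?_, ?_⟩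
        · simp [B, D, hv]
        · simp only [hc1]; rw [Int.cast_mul, Int.cast_natCast]; ring
        · simpa [B] using p1
        · exact ⟨by simp [B], rfl⟩
      have h3 : R (B A (N + 1)) ⟨.b t ⟨i, hlt⟩, .X t (i + 1) :: σ, c1⟩
          ⟨.L, .X t (i + 1) :: .X t (i + 1) :: σ, c1⟩ :=
        zstep A _ _ _ (some (.push (.X t (i + 1)))) _ _ _ rfl (by simpa [B] using p1)
          ⟨by simp [B], rfl⟩
      have h4 := ih (i + 1) (by omega) (.X t (i + 1) :: σ) c1 p1 q2
      have h5 := ih (i + 1) (by omega) σ c2 q2 (by rw [← q3]; exact hf)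
      rw [q3]
      exact ((((ReflTransGen.single h1).tail h2).tail h3).trans h4).trans h5

theorem complete (A : C1PVASS S Γ) (N : ℕ) (hN : ∀ t, val A t N = 0) (q : Config S Γ)
    (h : Reach A q) : Reach (B A (N + 1)) ⟨.st q.state, q.stack.map .old, q.counter⟩ := by
  induction h with
  | refl => exact ReflTransGen.refl
  | @tail q q' hq hs ih =>
    have hc0 := reach_nonneg A hq
    obtain ⟨g, u, op, hd, hg0, hg1, hc, hl, hok⟩ := hs
    let t : T A := ⟨(q.state, q'.state), by simp [hd]⟩
    have ht := delta_eq A t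
    have ht' : A.δ t.1.1 t.1.2 = some (u, op) := hd
    rw [ht'] at ht
    simp only [Option.some.injEq, Prod.mk.injEq] at ht
    obtain ⟨hu, hop⟩ := ht
    have hc' : q'.counter = q.counter + g * ((U A t).sign : ℝ) * val A t 0 := by
      rw [hc, val_zero, mul_assoc, sign_mul_natAbs_real, hu]
    have hc1 : 0 ≤ q'.counter := le_trans (Nat.cast_nonneg _) hl
    have h1 : R (B A (N + 1)) ⟨.st q.state, q.stack.map .old, q.counter⟩
        ⟨.m t, .ret t :: q.stack.map .old, q.counter⟩ :=
      zstep A _ _ _ (some (.push (.ret t))) _ _ _ (by simp [D, t]) (by simpa [B] using hc0)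
        ⟨by simp [B], rfl⟩
    have h2 : R (B A (N + 1)) ⟨.m t, .ret t :: q.stack.map .old, q.counter⟩
        ⟨.L, .X t 0 :: .ret t :: q.stack.map .old, q.counter⟩ :=
      zstep A _ _ _ (some (.push (.X t 0))) _ _ _ rfl (by simpa [B] using hc0)
        ⟨by simp [B], rfl⟩
    have h3 := loop A N t g hg0 hg1 (hN t) N 0 (by omega) (.ret t :: q.stack.map .old)
      q.counter hc0 (by rw [← hc']; exact hc1)
    rw [← hc'] at h3
    have h4 : R (B A (N + 1)) ⟨.L, .ret t :: q.stack.map .old, q'.counter⟩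
        ⟨.e t, q.stack.map .old, q'.counter⟩ :=
      zstep A _ _ _ (some (.pop (.ret t))) _ _ _ rfl (by simpa [B] using hc1)
        ⟨by simp [B], rfl⟩
    have h5 : R (B A (N + 1)) ⟨.e t, q.stack.map .old, q'.counter⟩
        ⟨.st q'.state, q'.stack.map .old, q'.counter⟩ :=
      zstep A _ _ _ (liftOp (Op A t)) _ _ _ (by simp [D, t]) hl
        (stack_lift' A _ _ _ _ (by rw [← hop]; exact hok))
    exact ((((ih.tail h1).tail h2).trans h3).tail h4).tail h5

theorem acc_eq (A : C1PVASS S Γ) (N : ℕ) (hN : ∀ t, val A t N = 0) :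
    A.AccValues = (B A (N + 1)).AccValues := by
  ext c
  rw [mem_acc, mem_acc]
  constructor
  · rintro ⟨α, h⟩
    exact ⟨_, complete A N hN _ h⟩
  · rintro ⟨α, h⟩
    obtain ⟨β, _, hr⟩ := sound A (N + 1) _ h
    exact ⟨β, hr⟩

/-- the new states as a sum type -/
def stEquiv (S T : Type) (N : ℕ) :
    St S T N ≃ S ⊕ T ⊕ T ⊕ (T × Fin N) ⊕ (T × Fin N) ⊕ Unit where
  toFun
    | .st s => .inl s
    | .m t => .inr (.inl t)
    | .e t => .inr (.inr (.inl t))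
    | .a t i => .inr (.inr (.inr (.inl (t, i))))
    | .b t i => .inr (.inr (.inr (.inr (.inl (t, i)))))
    | .L => .inr (.inr (.inr (.inr (.inr ()))))
  invFun
    | .inl s => .st s
    | .inr (.inl t) => .m t
    | .inr (.inr (.inl t)) => .e t
    | .inr (.inr (.inr (.inl (t, i)))) => .a t i
    | .inr (.inr (.inr (.inr (.inl (t, i))))) => .b t i
    | .inr (.inr (.inr (.inr (.inr ())))) => .L
  left_inv x := by cases x <;> rfl
  right_inv x := by rcases x with _ | _ | _ | _ | _ | _ <;> rfl

theorem card_St (S T : Type) (N : ℕ) [Finite S] [Finite T] :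
    Nat.card (St S T N) = Nat.card S + 2 * Nat.card T + 2 * (Nat.card T * N) + 1 := by
  rw [Nat.card_congr (stEquiv S T N)]
  simp only [Nat.card_sum, Nat.card_prod, Nat.card_unique, Nat.card_fin]
  ring

/-- code of a transition: source or target -/
def code {S T : Type} {N : ℕ} (p : St S T N × St S T N) : St S T N ⊕ St S T N :=
  match p.1 with
  | .st _ => .inr p.2
  | .L => .inr p.2
  | _ => .inl p.1

theorem code_inj (A : C1PVASS S Γ) (N : ℕ) (p q : St S (T A) N × St S (T A) N)
    (hp : (D A N p.1 p.2).isSome) (hq : (D A N q.1 q.2).isSome) (h : code p = code q) :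
    p = q := by
  obtain ⟨p1, p2⟩ := p
  obtain ⟨q1, q2⟩ := q
  cases p1 <;> cases p2 <;> simp [D] at hp <;>
  cases q1 <;> cases q2 <;> simp [D] at hq <;> simp_all [code]

theorem trans_le (A : C1PVASS S Γ) (N : ℕ) [Finite (St S (T A) N)] :
    transCount (B A N) ≤ 2 * Nat.card (St S (T A) N) := by
  have := Nat.card_le_card_of_injective
    (fun p : {p : St S (T A) N × St S (T A) N // ((B A N).δ p.1 p.2).isSome} => code p.1)
    (fun p q h => Subtype.ext (code_inj A N p.1 q.1 p.2 q.2 h))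
  rw [Nat.card_sum] at this
  unfold transCount
  omega

end Gadget

/-- There is a constant `C` such that for every C1PVASS `A` (with finite
state set and arbitrary integer counter updates, of absolute value at most `W`) there
is a C1PVASS `A'` whose counter updates all lie in `{-1,0,+1}` (over possibly larger
state and stack alphabets) such that for every `k ∈ ℝ≥0`, `A` has a `k`-reaching run
iff `A'` does, and `A` has a `k`-covering run iff `A'` does; moreover the number of
states plus transitions of `A'` is at most quadratic in
`|S| + |δ| + ⌈log₂ W⌉` (the size of the binary encoding of `A`). -/
theorem stmt18 :
    ∃ C : ℕ, ∀ (S Γ : Type) [Finite S] (A : C1PVASS S Γ) (W : ℕ),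
      (∀ s s' u op, A.δ s s' = some (u, op) → u.natAbs ≤ W) →
      ∃ (S' Γ' : Type) (_ : Finite S') (A' : C1PVASS S' Γ'),
        A'.UpdatesIn ∧
        (∀ k : ℝ, 0 ≤ k →
          ((k ∈ A.AccValues) ↔ (k ∈ A'.AccValues)) ∧
          ((∃ c ∈ A.AccValues, k ≤ c) ↔ (∃ c ∈ A'.AccValues, k ≤ c))) ∧
        Nat.card S' + transCount A' ≤
          C * (Nat.card S + transCount A + Nat.log 2 W + 1) ^ 2 := by
  refine ⟨30, fun S Γ _ A W hW => ?_⟩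
  have hT : Finite (Gadget.T A) := inferInstance
  let N := Nat.log 2 W + 1
  have hfin : Finite (Gadget.St S (Gadget.T A) (N + 1)) :=
    Finite.of_equiv _ (Gadget.stEquiv S (Gadget.T A) (N + 1)).symm
  have hN : ∀ t, Gadget.val A t N = 0 := by
    intro t
    have h1 := hW _ _ _ _ (Gadget.delta_eq A t)
    have h2 : W < 2 ^ N := Nat.lt_pow_succ_log_self (by norm_num) W
    exact Nat.div_eq_of_lt (lt_of_le_of_lt h1 h2)
  refine ⟨_, _, hfin, Gadget.B A (N + 1), Gadget.updates A _, ?_, ?_⟩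
  · intro k _
    rw [Gadget.acc_eq A N hN]
    exact ⟨Iff.rfl, Iff.rfl⟩
  · have h1 := Gadget.trans_le A (N + 1)
    have h2 := Gadget.card_St S (Gadget.T A) (N + 1)
    have h3 : transCount A = Nat.card (Gadget.T A) := rfl
    rw [h3]
    have h4 : N = Nat.log 2 W + 1 := rfl
    generalize Nat.card (Gadget.T A) = m at *
    generalize Nat.card S = n at *
    generalize Nat.log 2 W = l at *
    have h5 : Nat.card (Gadget.St S (Gadget.T A) (N + 1)) = n + 2 * m + 2 * (m * (l + 2)) + 1 := by
      rw [h2, h4]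
    nlinarith [Nat.zero_le (n * m), Nat.zero_le (n * l), Nat.zero_le (m * l), Nat.zero_le (n * n),
      Nat.zero_le (m * m), Nat.zero_le (l * l)]
end
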